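/- arXiv:2401.08883 — 3 statements merged into one kernel-verified Lean document; each statement's English description precedes it below -/
import Mathlib

section
/- Let (X,d) be a metric space, α, β : [0,1] → X be Cantor paths, and ε, δ > 0. Then there exists an increasing homeomorphism f : [0,1] → [0,1] such that sup_{t ∈ [0,1]} |f(t) − t| < δ, ρ(α, α ∘ f) < ε, and the Cantor paths α ∘ f and β are staggered. -/
open Set Filter Topology

noncomputable section

/-- An ℝ-tree: a nonempty geodesic, uniquely arcwise connected, locally arcwise connected
metric space. -/
structure IsRTree (T : Type) [MetricSpace T] : Prop where
  nonempty : Nonempty T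
  geodesic : ∀ x y : T, ∃ γ : ℝ → T, γ 0 = x ∧ γ (dist x y) = y ∧
    ∀ s ∈ Set.Icc (0:ℝ) (dist x y), ∀ t ∈ Set.Icc (0:ℝ) (dist x y),
      dist (γ s) (γ t) = |s - t|
  uniquelyArcwise : ∀ p q : unitInterval → T, Continuous p → Continuous q →
    Function.Injective p → Function.Injective q → p 0 = q 0 → p 1 = q 1 →
    Set.range p = Set.range q
  locallyArcwise : LocPathConnectedSpace T

/-- `β` is a geodesic ℝ-tree reduction of `α`, i.e. `α ≥ᵣ β`. -/
def GeodesicReduction {X : Type*} [TopologicalSpace X] (α β : unitInterval → X) : Prop :=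
  ∃ (T : Type) (_ : MetricSpace T), IsRTree T ∧
    ∃ (f : T → X) (p r : unitInterval → T),
      Continuous f ∧ Continuous p ∧ Continuous r ∧ Function.Injective r ∧
      r 0 = p 0 ∧ r 1 = p 1 ∧ f ∘ p = α ∧ f ∘ r = β

/-- The concatenation of `α` with the reverse of `β`: `α` on `[0,1/2]`, reverse of `β`
on `[1/2,1]`. -/
def ConcatReverse {X : Type*} (α β : unitInterval → X) : unitInterval → X :=
  fun t => if (t : ℝ) ≤ 1 / 2
    then α (Set.projIcc (0:ℝ) 1 zero_le_one (2 * (t : ℝ)))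
    else β (Set.projIcc (0:ℝ) 1 zero_le_one (2 - 2 * (t : ℝ)))

/-- The standard concatenation `α·β`: `α` on `[0,1/2]`, `β` on `[1/2,1]`. -/
def PathConcat {X : Type*} (α β : unitInterval → X) : unitInterval → X :=
  fun t => if (t : ℝ) ≤ 1 / 2
    then α (Set.projIcc (0:ℝ) 1 zero_le_one (2 * (t : ℝ)))
    else β (Set.projIcc (0:ℝ) 1 zero_le_one (2 * (t : ℝ) - 1))

/-- `α ≃ᵣ β`: the loop `α·(reverse β)` factors through an ℝ-tree. -/
def RTreeHomotopic {X : Type*} [TopologicalSpace X] (α β : unitInterval → X) : Prop :=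
  α 0 = β 0 ∧ α 1 = β 1 ∧
  ∃ (T : Type) (_ : MetricSpace T), IsRTree T ∧
    ∃ (f : T → X) (ℓ : unitInterval → T),
      Continuous f ∧ Continuous ℓ ∧ ℓ 0 = ℓ 1 ∧ f ∘ ℓ = ConcatReverse α β

/-- `α ≡ β`: equality up to an increasing self-homeomorphism of `[0,1]`. -/
def PathEquiv {X : Type*} (α β : unitInterval → X) : Prop :=
  ∃ h : unitInterval ≃ₜ unitInterval, StrictMono (⇑h) ∧ α = β ∘ ⇑h

/-- Fréchet equivalence of paths. -/
def FrechetEquiv {X : Type*} (α β : unitInterval → X) : Prop :=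
  ∃ f g : unitInterval → unitInterval,
    Continuous f ∧ Continuous g ∧ Monotone f ∧ Monotone g ∧
    Function.Surjective f ∧ Function.Surjective g ∧ α ∘ f = β ∘ g

/-- `p` lifts all paths uniquely rel. starting point. -/
def LiftsPathsUniquely {E X : Type*} [TopologicalSpace E] [TopologicalSpace X]
    (p : E → X) : Prop :=
  ∀ α : unitInterval → X, Continuous α → ∀ e : E, p e = α 0 →
    ∃! αl : unitInterval → E, Continuous αl ∧ αl 0 = e ∧ p ∘ αl = α

/-- An open `U ⊆ (0,1)` is a Cantor complement if `[0,1] \ U` is homeomorphic to the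
Cantor set. -/
def IsCantorComplement (U : Set ℝ) : Prop :=
  IsOpen U ∧ U ⊆ Set.Ioo 0 1 ∧ Nonempty (↥(Set.Icc (0:ℝ) 1 \ U) ≃ₜ (ℕ → Bool))

/-- `𝒪(α)`: the set of points of `[0,1]` (as reals) at which `α` is locally constant. -/
def Oset {X : Type*} [TopologicalSpace X] (α : unitInterval → X) : Set ℝ :=
  {x | ∃ hx : x ∈ unitInterval,
    ∃ U ∈ nhds (⟨x, hx⟩ : unitInterval), ∀ s ∈ U, α s = α ⟨x, hx⟩}

/-- A Cantor path: a non-constant path whose locally-constant set is a Cantor complement. -/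
def IsCantorPath {X : Type*} [TopologicalSpace X] (α : unitInterval → X) : Prop :=
  Continuous α ∧ (∃ s t, α s ≠ α t) ∧ IsCantorComplement (Oset α)

/-- Two Cantor paths are staggered if their locally-constant sets cover `(0,1)`. -/
def StaggeredPaths {X : Type*} [TopologicalSpace X] (α β : unitInterval → X) : Prop :=
  Oset α ∪ Oset β = Set.Ioo 0 1

/-- The restriction of `β` to `[a,b]`, linearly reparameterized on `[0,1]`. -/
def restrictIcc {X : Type*} (β : unitInterval → X) (a b : ℝ) : unitInterval → X :=
  fun t => β (Set.projIcc (0:ℝ) 1 zero_le_one (a + (b - a) * (t : ℝ)))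

/-- A Cantor-inverse-pair loop (CIP-loop). -/
def IsCIPLoop {X : Type*} [TopologicalSpace X] (ℓ : unitInterval → X) : Prop :=
  ∃ (α : unitInterval → X) (h : unitInterval ≃ₜ unitInterval), StrictMono (⇑h) ∧
    ℓ ∘ ⇑h = ConcatReverse α α ∧
    (IsCantorPath α ∨
      ∃ (α₁ : unitInterval → X) (x : X) (h' : unitInterval ≃ₜ unitInterval),
        StrictMono (⇑h') ∧ IsCantorPath α₁ ∧ α ∘ ⇑h' = PathConcat α₁ (fun _ => x))

/-- `β` is a `𝒰`-extension of `α` for `𝒰` a set of connected components of `𝒪(α)`. -/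
def UExtension {X : Type*} [TopologicalSpace X] (α β : unitInterval → X)
    (𝒰 : Set (Set ℝ)) : Prop :=
  (∀ J ∈ 𝒰, ∃ x ∈ Oset α, J = connectedComponentIn (Oset α) x) ∧
  (∀ t : unitInterval, (t : ℝ) ∉ ⋃₀ 𝒰 → β t = α t) ∧
  (∀ J ∈ 𝒰, IsCIPLoop (restrictIcc β (sInf J) (sSup J)))

/-- `α ⪯* β`: `β` is a `𝒰`-extension of `α` for some `𝒰 ⊆ lc(α)`. -/
def PrecExt {X : Type*} [TopologicalSpace X] (α β : unitInterval → X) : Prop :=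
  ∃ 𝒰 : Set (Set ℝ), UExtension α β 𝒰

/-- The sup-metric `ρ` on paths into a metric space. -/
def pathDist {X : Type*} [PseudoMetricSpace X] (α β : unitInterval → X) : ℝ :=
  ⨆ t : unitInterval, dist (α t) (β t)

/-- The image of a set `U ⊆ [0,1] ⊆ ℝ` under a self-homeomorphism of `[0,1]`. -/
def imageOnIcc (f : unitInterval ≃ₜ unitInterval) (U : Set ℝ) : Set ℝ :=
  Subtype.val '' (⇑f '' (Subtype.val ⁻¹' U))

/-- The Euclidean half-space of dimension `n` (all of `ℝ⁰` when `n = 0`). -/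
def halfSpace (n : ℕ) : Set (EuclideanSpace ℝ (Fin n)) :=
  {y | ∀ i : Fin n, (i : ℕ) = 0 → 0 ≤ y i}

/-- A topological manifold with (possibly empty) boundary: second countable, Hausdorff,
locally homeomorphic to open subsets of Euclidean half-spaces. -/
def IsTopManifold (M : Type*) [TopologicalSpace M] : Prop :=
  SecondCountableTopology M ∧ T2Space M ∧
  ∀ x : M, ∃ (n : ℕ) (U : Set M) (V : Set (halfSpace n)),
    U ∈ nhds x ∧ IsOpen V ∧ Nonempty (↥U ≃ₜ ↥V)

/-- The closed unit disk in the Euclidean plane. -/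
abbrev Disk2 : Type := ↥(Metric.closedBall (0 : EuclideanSpace ℝ (Fin 2)) 1)

end

/-- Gluing order isomorphisms along the fibres of a monotone map which they preserve. -/
theorem exists_orderIso_of_fibers {α ι : Type*} [LinearOrder α] [PartialOrder ι] (k : α → ι)
    (hk : Monotone k) (g : ι → α ≃o α) (hg : ∀ x, k (g (k x) x) = k x)
    (hg' : ∀ x, k ((g (k x)).symm x) = k x) : ∃ e : α ≃o α, ∀ x, e x = g (k x) x := by
  have hmono : StrictMono fun x => g (k x) x := by
    intro s t hst
    show g (k s) s < g (k t) t
    rcases (hk hst.le).eq_or_lt with h | h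
    · rw [h]
      exact (g (k t)).strictMono hst
    · by_contra! hle
      have := hk hle
      rw [hg, hg] at this
      exact h.not_ge this
  refine ⟨hmono.orderIsoOfRightInverse _ (fun x => (g (k x)).symm x) fun x => ?_, fun x => rfl⟩
  simp only [hg', OrderIso.apply_symm_apply]

theorem exists_orderIso_fix_Iic_map {c x y : ℝ} (hx : c < x) (hy : c < y) :
    ∃ e : ℝ ≃o ℝ, (∀ z ≤ c, e z = z) ∧ e x = y := by
  have hs : 0 < (y - c) / (x - c) := div_pos (sub_pos.2 hy) (sub_pos.2 hx)
  set s := (y - c) / (x - c) with hs_def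
  have hmono : StrictMono fun z : ℝ => if z ≤ c then z else c + s * (z - c) := by
    intro z w hzw
    dsimp only
    split_ifs with h₁ h₂ h₂
    · exact hzw
    · nlinarith [mul_pos hs (sub_pos.2 (not_le.1 h₂))]
    · linarith
    · nlinarith
  refine ⟨hmono.orderIsoOfRightInverse _ (fun z => if z ≤ c then z else c + (z - c) / s)
    fun z => ?_, fun z hz => if_pos hz, ?_⟩
  · by_cases h : z ≤ c
    · simp [h]
    · have : 0 < (z - c) / s := div_pos (by linarith) hs
      dsimp only
      rw [if_neg h, if_neg (by linarith)]
      field_simp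
      ring
  · show (if x ≤ c then x else c + s * (x - c)) = y
    rw [if_neg hx.not_ge, hs_def, div_mul_cancel₀ _ (sub_pos.2 hx).ne']
    ring

theorem exists_orderIso_disjoint_Icc {A B : Set ℝ} (hA : IsClosed A) (hB : IsClosed B)
    (hAd : Dense Aᶜ) {a b : ℝ} (hab : a < b) (ha : a ∉ B) (hb : b ∉ B) :
    ∃ e : ℝ ≃o ℝ, e a = a ∧ e b = b ∧ ∀ x ∈ B, x ∈ Icc a b → e x ∉ A := by
  obtain ⟨w, hwA, hw⟩ := hAd.exists_mem_open isOpen_Ioo (nonempty_Ioo.2 hab)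
  obtain ⟨s, hs, hsA⟩ := Metric.isOpen_iff.1 hA.isOpen_compl w hwA
  obtain ⟨r, hr, hrB⟩ := Metric.isOpen_iff.1 hB.isOpen_compl a ha
  obtain ⟨r', hr', hrB'⟩ := Metric.isOpen_iff.1 hB.isOpen_compl b hb
  obtain ⟨v, hwv, hv⟩ := exists_between (lt_min (lt_add_of_pos_right w hs) hw.2)
  obtain ⟨p, hap, hp⟩ := exists_between (lt_min (lt_add_of_pos_right a hr) hab)
  rw [lt_min_iff] at hv hp
  obtain ⟨q, hq, hqb⟩ := exists_between (max_lt (sub_lt_self b hr') hp.2)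
  rw [max_lt_iff] at hq
  obtain ⟨e₁, h₁, h₁p⟩ := exists_orderIso_fix_Iic_map hap hw.1
  obtain ⟨e₂, h₂, h₂q⟩ := exists_orderIso_fix_Iic_map (x := e₁ q) (h₁p ▸ e₁.strictMono hq.2) hwv
  obtain ⟨e₃, h₃, h₃b⟩ := exists_orderIso_fix_Iic_map (x := e₂ (e₁ b))
    (h₂q ▸ e₂.strictMono (e₁.strictMono hqb)) hv.2
  refine ⟨(e₁.trans e₂).trans e₃, ?_, h₃b, fun x hx hxab => ?_⟩
  · simp only [OrderIso.trans_apply]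
    rw [h₁ a le_rfl, h₂ a hw.1.le, h₃ a (hw.1.trans hwv).le]
  · have hpx : p ≤ x := by
      by_contra! h
      refine absurd hx (hrB ?_)
      rw [Metric.mem_ball, Real.dist_eq, abs_lt]
      constructor <;> linarith [hxab.1]
    have hxq : x ≤ q := by
      by_contra! h
      refine absurd hx (hrB' ?_)
      rw [Metric.mem_ball, Real.dist_eq, abs_lt]
      constructor <;> linarith [hxab.2]
    have hlow : w ≤ e₂ (e₁ x) := by
      have := e₂.monotone (e₁.monotone hpx)
      rwa [h₁p, h₂ w le_rfl] at this
    have hhigh : e₂ (e₁ x) ≤ v := h₂q ▸ e₂.monotone (e₁.monotone hxq)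
    simp only [OrderIso.trans_apply]
    rw [h₃ _ hhigh]
    apply hsA
    rw [Metric.mem_ball, Real.dist_eq, abs_lt]
    constructor <;> linarith [hv.1]

theorem Real.sigmoid_sub_le {x y : ℝ} (h : x ≤ y) : sigmoid y - sigmoid x ≤ y - x := by
  have := image_sub_le_mul_sub_of_deriv_le differentiable_sigmoid (C := 1) (fun x => by
    rw [deriv_sigmoid]
    nlinarith [sigmoid_pos x, sigmoid_lt_one x]) h
  linarith

/-- A set with dense complement admits a locally finite bi-infinite subdivision of `(0,1)` of
small mesh whose points avoid it. -/
theorem exists_int_subdivision_Ioo {B : Set ℝ} (hB : Dense Bᶜ) {η : ℝ} (hη : 0 < η) :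
    ∃ c : ℤ → ℝ, StrictMono c ∧ (∀ m, c m ∈ Ioo 0 1) ∧ (∀ m, c m ∉ B) ∧
      (∀ m, c (m + 1) - c m < η) ∧ ∀ x ∈ Ioo (0 : ℝ) 1, ∃ m, x ∈ Ico (c m) (c (m + 1)) := by
  set a : ℤ → ℝ := fun m => Real.sigmoid (η / 2 * m) with ha
  have ha_mono : StrictMono a := fun m n h => Real.sigmoid_lt <| by
    have : (m : ℝ) < n := by exact_mod_cast h
    gcongr
  have hex : ∀ m, ∃ x ∈ Bᶜ, x ∈ Ioo (a m) (a (m + 1)) := fun m =>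
    hB.exists_mem_open isOpen_Ioo (nonempty_Ioo.2 (ha_mono (lt_add_one m)))
  choose c hcB hc using hex
  refine ⟨c, strictMono_int_of_lt_succ fun m => (hc m).2.trans (hc (m + 1)).1,
    fun m => ⟨(Real.sigmoid_pos _).trans (hc m).1, (hc m).2.trans (Real.sigmoid_lt_one _)⟩,
    hcB, fun m => ?_, fun x hx => ?_⟩
  · have h₁ := (hc m).1
    have h₂ := (hc (m + 1)).2
    have h₃ : a (m + 1 + 1) - a m ≤ η / 2 * ((m + 1 + 1 : ℤ) : ℝ) - η / 2 * m :=
      Real.sigmoid_sub_le (by push_cast; nlinarith)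
    push_cast at h₃
    linarith
  · obtain ⟨y, rfl⟩ : x ∈ range Real.sigmoid := Real.range_sigmoid ▸ hx
    set m := ⌊y / (η / 2)⌋ with hm
    have h₁ : a m ≤ Real.sigmoid y := Real.sigmoid_le <| by
      have := (le_div_iff₀ (half_pos hη)).1 (Int.floor_le (y / (η / 2)))
      rw [← hm] at this
      linarith
    have h₂ : Real.sigmoid y < a (m + 1) := Real.sigmoid_lt <| by
      have := (div_lt_iff₀ (half_pos hη)).1 (Int.lt_floor_add_one (y / (η / 2)))
      rw [← hm] at this
      push_cast
      linarith
    rcases le_or_gt (c m) (Real.sigmoid y) with h | h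
    · exact ⟨m, h, h₂.trans (hc (m + 1)).1⟩
    · refine ⟨m - 1, ?_, by simpa using h⟩
      have := (hc (m - 1)).2
      rw [sub_add_cancel] at this
      exact this.le.trans h₁

/-- A closed set with dense complement can be moved off another one inside `(0,1)` by a small
order isomorphism. -/
theorem exists_orderIso_disjoint_Ioo {A B : Set ℝ} (hA : IsClosed A) (hB : IsClosed B)
    (hAd : Dense Aᶜ) (hBd : Dense Bᶜ) {η : ℝ} (hη : 0 < η) :
    ∃ e : ℝ ≃o ℝ, (∀ x ∉ Ioo (0 : ℝ) 1, e x = x) ∧ (∀ x, |e x - x| ≤ η) ∧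
      ∀ x ∈ B, x ∈ Ioo (0 : ℝ) 1 → e x ∉ A := by
  obtain ⟨c, hc, hc01, hcB, hmesh, hcov⟩ := exists_int_subdivision_Ioo hBd hη
  set k : ℝ → Set ℤ := fun x => {i | c i ≤ x} with hk_def
  have hk : Monotone k := fun x y hxy i hi => le_trans hi hxy
  have hfib : ∀ {m x}, x ∈ Ico (c m) (c (m + 1)) → k x = Iic m := by
    intro m x hx
    ext i
    refine ⟨fun hi => ?_, fun hi => (hc.monotone hi).trans hx.1⟩
    exact Int.lt_add_one_iff.1 (hc.lt_iff_lt.1 (lt_of_le_of_lt hi hx.2))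
  have hfib' : ∀ {m x}, k x = Iic m → x ∈ Ico (c m) (c (m + 1)) := by
    intro m x hx
    refine ⟨(hx ▸ mem_Iic.2 le_rfl : m ∈ k x), not_le.1 fun h => ?_⟩
    have : m + 1 ∈ Iic m := hx ▸ h
    simp at this
  have key : ∀ S : Set ℤ, ∃ g : ℝ ≃o ℝ, ∀ x, k x = S →
      k (g x) = S ∧ k (g.symm x) = S ∧ (x ∉ Ioo (0 : ℝ) 1 → g x = x) ∧ |g x - x| ≤ η ∧
        (x ∈ B → x ∈ Ioo (0 : ℝ) 1 → g x ∉ A) := by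
    intro S
    by_cases hS : ∃ x₀ ∈ Ioo (0 : ℝ) 1, k x₀ = S
    · obtain ⟨x₀, hx₀, rfl⟩ := hS
      obtain ⟨m, hm⟩ := hcov x₀ hx₀
      rw [hfib hm]
      obtain ⟨g, hga, hgb, hg⟩ := exists_orderIso_disjoint_Icc hA hB hAd
        (hc (lt_add_one m)) (hcB m) (hcB (m + 1))
      refine ⟨g, fun x hx => ?_⟩
      replace hx := hfib' hx
      have hgx : g x ∈ Ico (c m) (c (m + 1)) :=
        ⟨hga ▸ g.monotone hx.1, hgb ▸ g.strictMono hx.2⟩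
      refine ⟨hfib hgx, hfib ⟨g.le_symm_apply.2 (hga.symm ▸ hx.1), ?_⟩, fun h => ?_, ?_,
        fun hxB _ => hg x hxB (Ico_subset_Icc_self hx)⟩
      · exact g.symm_apply_lt.2 (hgb.symm ▸ hx.2)
      · exact absurd ⟨(hc01 m).1.trans_le hx.1, hx.2.trans (hc01 (m + 1)).2⟩ h
      · rw [abs_le]
        constructor <;> linarith [hmesh m, hx.1, hx.2, hgx.1, hgx.2]
    · refine ⟨OrderIso.refl ℝ, fun x hx => ⟨hx, hx, fun _ => rfl, ?_, fun _ h => ?_⟩⟩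
      · simpa using hη.le
      · exact absurd ⟨x, h, hx⟩ hS
  choose g hg using key
  obtain ⟨e, he⟩ := exists_orderIso_of_fibers k hk g (fun x => (hg _ x rfl).1)
    fun x => (hg _ x rfl).2.1
  refine ⟨e, fun x hx => ?_, fun x => ?_, fun x hxB hx => ?_⟩ <;> rw [he]
  · exact (hg _ x rfl).2.2.1 hx
  · exact (hg _ x rfl).2.2.2.1
  · exact (hg _ x rfl).2.2.2.2 hxB hx

theorem IsCantorComplement.isClosed_diff {U : Set ℝ} (hU : IsCantorComplement U) :
    IsClosed (Icc (0 : ℝ) 1 \ U) :=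
  isClosed_Icc.sdiff hU.1

theorem IsCantorComplement.dense_compl_diff {U : Set ℝ} (hU : IsCantorComplement U) :
    Dense (Icc (0 : ℝ) 1 \ U)ᶜ := by
  obtain ⟨φ⟩ := hU.2.2
  have htd : IsTotallyDisconnected (Icc (0 : ℝ) 1 \ U) :=
    totallyDisconnectedSpace_subtype_iff.1 φ.symm.totallyDisconnectedSpace
  rw [← interior_eq_empty_iff_dense_compl, eq_empty_iff_forall_notMem]
  intro x hx
  obtain ⟨r, hr, hball⟩ := Metric.isOpen_iff.1 isOpen_interior x hx
  have hsub := htd (Metric.ball x r) (hball.trans interior_subset)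
    (Real.ball_eq_Ioo x r ▸ isPreconnected_Ioo)
  have := hsub (Metric.mem_ball_self hr) (y := x + r / 2)
    (by rw [Metric.mem_ball, Real.dist_eq, add_sub_cancel_left, abs_of_pos (half_pos hr)]; linarith)
  linarith

theorem mem_Oset_coe {X : Type*} [TopologicalSpace X] {α : unitInterval → X} {t : unitInterval} :
    (t : ℝ) ∈ Oset α ↔ ∀ᶠ s in 𝓝 t, α s = α t := by
  rw [Filter.eventually_iff_exists_mem]
  exact ⟨fun ⟨_, h⟩ => h, fun h => ⟨t.2, h⟩⟩

theorem mem_Oset_comp_homeomorph {X : Type*} [TopologicalSpace X] {α : unitInterval → X}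
    (f : unitInterval ≃ₜ unitInterval) {t : unitInterval} :
    (t : ℝ) ∈ Oset (α ∘ f) ↔ (f t : ℝ) ∈ Oset α := by
  rw [mem_Oset_coe, mem_Oset_coe, ← f.map_nhds_eq, Filter.eventually_map]
  rfl

theorem IsCantorComplement.of_homeomorph {U V : Set ℝ} (hU : IsCantorComplement U)
    (hV : V ⊆ Icc 0 1) (f : unitInterval ≃ₜ unitInterval) (h0 : f 0 = 0) (h1 : f 1 = 1)
    (hVU : ∀ t : unitInterval, (t : ℝ) ∈ V ↔ (f t : ℝ) ∈ U) : IsCantorComplement V := by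
  have hV01 : V ⊆ Ioo 0 1 := by
    intro x hx
    refine ⟨lt_of_le_of_ne (hV hx).1 ?_, lt_of_le_of_ne (hV hx).2 ?_⟩
    · rintro rfl
      have := hU.2.1 ((hVU 0).1 hx)
      simp [h0] at this
    · rintro rfl
      have := hU.2.1 ((hVU 1).1 hx)
      simp [h1] at this
  obtain ⟨φ⟩ := hU.2.2
  refine ⟨?_, hV01, ⟨Homeomorph.trans ?_ φ⟩⟩
  · have hopen : IsOpen {t : unitInterval | (f t : ℝ) ∈ U} :=
      hU.1.preimage (continuous_subtype_val.comp f.continuous)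
    obtain ⟨W, hW, hWU⟩ := isOpen_induced_iff.1 hopen
    have : V = W ∩ Ioo 0 1 := by
      ext x
      constructor
      · intro hx
        refine ⟨?_, hV01 hx⟩
        have : (⟨x, hV hx⟩ : unitInterval) ∈ Subtype.val ⁻¹' W := hWU ▸ (hVU _).1 hx
        exact this
      · rintro ⟨hxW, hx⟩
        have : (⟨x, Ioo_subset_Icc_self hx⟩ : unitInterval) ∈
          {t : unitInterval | (f t : ℝ) ∈ U} := hWU ▸ hxW
        exact (hVU _).2 this
    exact this ▸ hW.inter isOpen_Ioo
  · exact
      { toFun := fun x => ⟨f ⟨x, x.2.1⟩, (f ⟨x, x.2.1⟩).2, fun h => x.2.2 ((hVU _).2 h)⟩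
        invFun := fun y => ⟨f.symm ⟨y, y.2.1⟩, (f.symm ⟨y, y.2.1⟩).2, fun h =>
          y.2.2 (by simpa using (hVU _).1 h)⟩
        left_inv := fun x => by simp
        right_inv := fun y => by simp
        continuous_toFun := by fun_prop
        continuous_invFun := by fun_prop }

theorem IsCantorPath.comp_homeomorph {X : Type*} [TopologicalSpace X] {α : unitInterval → X}
    (hα : IsCantorPath α) (f : unitInterval ≃ₜ unitInterval) (h0 : f 0 = 0) (h1 : f 1 = 1) :
    IsCantorPath (α ∘ f) := by
  obtain ⟨hcont, ⟨s, t, hst⟩, hO⟩ := hα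
  exact ⟨hcont.comp f.continuous, ⟨f.symm s, f.symm t, by simpa using hst⟩,
    hO.of_homeomorph (fun x hx => hx.1) f h0 h1 fun t => mem_Oset_comp_homeomorph f⟩

/-- An order isomorphism of `ℝ` fixing `0` and `1` restricts to the unit interval. -/
theorem exists_unitInterval_homeomorph (e : ℝ ≃o ℝ) (h0 : e 0 = 0) (h1 : e 1 = 1) :
    ∃ f : unitInterval ≃ₜ unitInterval, StrictMono f ∧ ∀ t, (f t : ℝ) = e t := by
  have hmem : ∀ x : ℝ, x ∈ unitInterval ↔ e x ∈ unitInterval := fun x => by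
    have h := e.le_iff_le (x := 0) (y := x)
    have h' := e.le_iff_le (x := x) (y := 1)
    rw [h0] at h
    rw [h1] at h'
    rw [unitInterval, mem_Icc, mem_Icc, h, h']
  let o : unitInterval ≃o unitInterval :=
    { toEquiv := e.toEquiv.subtypeEquiv hmem
      map_rel_iff' := e.le_iff_le }
  exact ⟨o.toHomeomorph, o.strictMono, fun t => rfl⟩

/-- Any two Cantor paths may be staggered by an arbitrarily small perturbation of the
first one. -/
theorem cantorPaths_stagger {X : Type*} [MetricSpace X] (α β : unitInterval → X)
    (hα : IsCantorPath α) (hβ : IsCantorPath β)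
    (ε δ : ℝ) (hε : 0 < ε) (hδ : 0 < δ) :
    ∃ f : unitInterval ≃ₜ unitInterval, StrictMono (⇑f) ∧
      (⨆ t : unitInterval, |((f t : ℝ)) - (t : ℝ)|) < δ ∧
      pathDist α (α ∘ ⇑f) < ε ∧
      IsCantorPath (α ∘ ⇑f) ∧ StaggeredPaths (α ∘ ⇑f) β := by
  obtain ⟨δ', hδ', hα'⟩ := Metric.uniformContinuous_iff.1
    (CompactSpace.uniformContinuous_of_continuous hα.1) (ε / 2) (half_pos hε)
  have hη : 0 < min δ δ' / 2 := half_pos (lt_min hδ hδ')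
  obtain ⟨e, hfix, hclose, hdisj⟩ := exists_orderIso_disjoint_Ioo hα.2.2.isClosed_diff
    hβ.2.2.isClosed_diff hα.2.2.dense_compl_diff hβ.2.2.dense_compl_diff hη
  obtain ⟨f, hf, hfe⟩ := exists_unitInterval_homeomorph e (hfix 0 (by simp)) (hfix 1 (by simp))
  have h0 : f 0 = 0 := Subtype.ext ((hfe 0).trans (hfix 0 (by simp)))
  have h1 : f 1 = 1 := Subtype.ext ((hfe 1).trans (hfix 1 (by simp)))
  have hft : ∀ t : unitInterval, |(f t : ℝ) - t| ≤ min δ δ' / 2 := fun t => hfe t ▸ hclose t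
  have hαf := hα.comp_homeomorph f h0 h1
  refine ⟨f, hf, ?_, ?_, hαf, ?_⟩
  · refine (ciSup_le hft).trans_lt ?_
    linarith [min_le_left δ δ']
  · refine (ciSup_le fun t => (hα' ?_).le).trans_lt (half_lt_self hε)
    rw [dist_comm, Subtype.dist_eq, Real.dist_eq]
    linarith [hft t, min_le_right δ δ']
  · refine Subset.antisymm (union_subset hαf.2.2.2.1 hβ.2.2.2.1) fun x hx => ?_
    have hxI : x ∈ unitInterval := Ioo_subset_Icc_self hx
    by_contra hnot
    rw [mem_union, not_or] at hnot
    have hfx : (f ⟨x, hxI⟩ : ℝ) ∉ Oset α := fun h =>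
      hnot.1 ((mem_Oset_comp_homeomorph f (t := ⟨x, hxI⟩)).2 h)
    exact hdisj x ⟨hxI, hnot.2⟩ hx (hfe ⟨x, hxI⟩ ▸ ⟨(f ⟨x, hxI⟩).2, hfx⟩)
end

section
/- Suppose {f_n} (n ∈ ℕ, n ≥ 1) is a sequence of increasing homeomorphisms f_n : [0,1] → [0,1] such that sup_{t ∈ [0,1]} |f_n(t) − t| ≤ a·rⁿ for some a > 0 and some r with 0 ≤ r < 1. If g_n = f_n⁻¹ ∘ f_{n−1}⁻¹ ∘ ⋯ ∘ f_2⁻¹ ∘ f_1⁻¹ for all n, then the sequence {g_n} converges uniformly to a continuous, nondecreasing surjection g_∞ : [0,1] → [0,1]. -/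
open Set Filter Topology

/-- A sequence of functions into a complete space whose consecutive uniform distances are
bounded by a geometric sequence converges uniformly. -/
theorem exists_tendstoUniformly_of_dist_le_geometric {X Y : Type*} [MetricSpace Y]
    [CompleteSpace Y] {F : ℕ → X → Y} {C r : ℝ} (hr0 : 0 ≤ r) (hr1 : r < 1)
    (hF : ∀ n x, dist (F n x) (F (n + 1) x) ≤ C * r ^ n) :
    ∃ G : X → Y, TendstoUniformly F G atTop := by
  have hlim : ∀ x, ∃ y, Tendsto (fun n => F n x) atTop (𝓝 y) := fun x =>
    cauchySeq_tendsto_of_complete (cauchySeq_of_le_geometric r C hr1 fun n => hF n x)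
  choose G hG using hlim
  refine ⟨G, Metric.tendstoUniformly_iff.2 fun ε hε => ?_⟩
  have hzero : Tendsto (fun n : ℕ => C * r ^ n / (1 - r)) atTop (𝓝 0) := by
    simpa using ((tendsto_pow_atTop_nhds_zero_of_lt_one hr0 hr1).const_mul C).div_const (1 - r)
  filter_upwards [hzero.eventually_lt_const hε] with n hn x
  rw [dist_comm]
  exact (dist_le_of_le_geometric_of_tendsto r C hr1 (fun n => hF n x) (hG x) n).trans_lt hn

/-- The inverse of a homeomorphism of the unit interval is uniformly as close to the identity as
the homeomorphism itself. -/
theorem dist_symm_apply_le_of_iSup_le (f : unitInterval ≃ₜ unitInterval) {c : ℝ}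
    (hf : (⨆ t : unitInterval, |((f t : ℝ)) - (t : ℝ)|) ≤ c) (x : unitInterval) :
    dist x (f.symm x) ≤ c := by
  have hbdd : BddAbove (range fun t : unitInterval => |((f t : ℝ)) - (t : ℝ)|) :=
    (isCompact_range (by fun_prop)).bddAbove
  simpa [Subtype.dist_eq, Real.dist_eq] using (le_ciSup hbdd (f.symm x)).trans hf

/-- Infinite compositions of geometrically small increasing self-homeomorphisms of `[0,1]`
converge uniformly to a continuous nondecreasing surjection. -/
theorem infinite_composition_converges (f : ℕ → (unitInterval ≃ₜ unitInterval))
    (hmono : ∀ n, 1 ≤ n → StrictMono (⇑(f n)))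
    (a r : ℝ) (ha : 0 < a) (hr0 : 0 ≤ r) (hr1 : r < 1)
    (hbound : ∀ n, 1 ≤ n →
      (⨆ t : unitInterval, |(((f n) t : ℝ)) - (t : ℝ)|) ≤ a * r ^ n)
    (g : ℕ → unitInterval → unitInterval)
    (hg1 : g 1 = ⇑(f 1).symm)
    (hgs : ∀ n, 1 ≤ n → g (n + 1) = ⇑(f (n + 1)).symm ∘ g n) :
    ∃ glim : unitInterval → unitInterval, Continuous glim ∧ Monotone glim ∧
      Function.Surjective glim ∧
      TendstoUniformly (fun n => g n) glim Filter.atTop := by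
  have hg : ∀ n, Continuous (g (n + 1)) ∧ Monotone (g (n + 1)) ∧
      Function.Surjective (g (n + 1)) := by
    have hsymm : ∀ n, Monotone (f (n + 1)).symm := fun n x y hxy =>
      (hmono (n + 1) (by omega)).le_iff_le.1 (by simpa using hxy)
    intro n
    induction n with
    | zero => exact hg1 ▸ ⟨(f 1).symm.continuous, hsymm 0, (f 1).symm.surjective⟩
    | succ n ih =>
      rw [hgs (n + 1) (by omega)]
      exact ⟨(f _).symm.continuous.comp ih.1, (hsymm _).comp ih.2.1,
        (f _).symm.surjective.comp ih.2.2⟩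
  obtain ⟨G, hG⟩ := exists_tendstoUniformly_of_dist_le_geometric
    (F := fun n => g (n + 1)) (C := a * r ^ 2) hr0 hr1 fun n x => by
      rw [hgs (n + 1) (by omega), mul_assoc, ← pow_add, add_comm 2 n]
      exact dist_symm_apply_le_of_iSup_le _ (hbound (n + 2) (by omega)) _
  have hcont : Continuous G := hG.continuous (Frequently.of_forall fun n => (hg n).1)
  have hzero : G 0 = 0 := tendsto_nhds_unique (hG.tendsto_at 0) <|
    tendsto_const_nhds.congr fun n => by
      obtain ⟨x, hx⟩ := (hg n).2.2 0
      exact le_antisymm unitInterval.nonneg' (((hg n).2.1 unitInterval.nonneg').trans_eq hx)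
  have hone : G 1 = 1 := tendsto_nhds_unique (hG.tendsto_at 1) <|
    tendsto_const_nhds.congr fun n => by
      obtain ⟨x, hx⟩ := (hg n).2.2 1
      exact le_antisymm (hx.symm.trans_le ((hg n).2.1 unitInterval.le_one')) unitInterval.le_one'
  refine ⟨G, hcont, fun x y hxy => ?_, fun y => ?_, ?_⟩
  · exact le_of_tendsto_of_tendsto' (hG.tendsto_at x) (hG.tendsto_at y)
      fun n => (hg n).2.1 hxy
  · exact mem_range_of_exists_le_of_exists_ge hcont
      ⟨0, hzero.trans_le unitInterval.nonneg'⟩ ⟨1, unitInterval.le_one'.trans_eq hone.symm⟩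
  · rw [← map_add_atTop_eq_nat 1]
    exact fun u hu => hG u hu
end

section
/- If {γ_n} (n ∈ ℕ) is a sequence of Cantor paths in a metric space (X,d) such that γ_n ⪯* γ_{n+1} for all n and such that {γ_n} converges uniformly to a path γ : [0,1] → X, then γ_n ≃ᵣ γ for all n ∈ ℕ. -/
open Set Filter Topology

section FourPoint

variable {T : Type} [MetricSpace T]

/-- Gromov's four-point condition for `0`-hyperbolic spaces. -/
def FourPoint (T : Type) [MetricSpace T] : Prop :=
  ∀ x y z w : T, dist x y + dist z w ≤ dist x z + dist y w ∨
    dist x y + dist z w ≤ dist x w + dist y z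

theorem FourPoint.dist_between (h4 : FourPoint T) {x y z w : T}
    (hz : dist x z + dist z y = dist x y) (hw : dist x w + dist w y = dist x y) :
    dist z w = |dist x z - dist x w| := by
  apply le_antisymm
  · rcases h4 x y z w with h | h
    · rw [dist_comm y w] at h
      exact le_trans (by linarith) (le_abs_self _)
    · rw [dist_comm y z] at h
      exact le_trans (by linarith) (neg_le_abs _)
  · have := abs_dist_sub_le z w x
    rwa [dist_comm z x, dist_comm w x] at this

theorem FourPoint.exists_path_eq (h4 : FourPoint T) {p : unitInterval → T} (hp : Continuous p)
    {s t : unitInterval} {z : T} (hz : dist (p s) z + dist z (p t) = dist (p s) (p t)) :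
    ∃ u ∈ uIcc s t, p u = z := by
  by_contra! hne
  set x := p s with hx
  set y := p t with hy
  let π : T → ℝ := fun w => dist x w - dist w y
  have hπ : Continuous π := by fun_prop
  have hK : IsPreconnected (p '' uIcc s t) := isPreconnected_uIcc.image _ hp.continuousOn
  have hA : IsOpen {w | π w < π z} := isOpen_lt hπ continuous_const
  have hB : IsOpen {w | π z ≤ π w ∧ w ≠ z} := by
    rw [isOpen_iff_mem_nhds]
    rintro w ⟨hw, hwz⟩
    rcases hw.lt_or_eq with hlt | heq
    · filter_upwards [(isOpen_lt continuous_const hπ).mem_nhds hlt, isOpen_ne.mem_nhds hwz]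
        with v h1 h2
      exact ⟨le_of_lt h1, h2⟩
    · have hd : 0 < dist w z := dist_pos.2 hwz
      filter_upwards [Metric.ball_mem_nhds w hd] with v hv
      rw [Metric.mem_ball, dist_comm] at hv
      refine ⟨?_, fun h => by rw [h] at hv; exact lt_irrefl _ hv⟩
      simp only [π] at heq ⊢
      have e1 := dist_comm w y
      have e2 := dist_comm z y
      have e3 := dist_comm w z
      have t1 := dist_triangle x z w
      have t2 := dist_triangle y z w
      have t3 := dist_triangle x z v
      have t4 := dist_triangle y z v
      have e4 := dist_comm v y
      have k1 := h4 x y z w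
      have h1 : dist x w = dist x z + dist z w := by
        rcases k1 with k | k <;> linarith
      have h2 : dist y w = dist y z + dist z w := by
        rcases k1 with k | k <;> linarith
      have p0 : 0 ≤ dist z v := dist_nonneg
      have h3 : dist x v = dist x z + dist z v := by
        rcases h4 x w z v with k | k <;> linarith
      have h5 : dist y v = dist y z + dist z v := by
        rcases h4 y w z v with k | k <;> linarith
      linarith
  have hxz : x ≠ z := hne s left_mem_uIcc
  have hyz : y ≠ z := hne t right_mem_uIcc
  obtain ⟨v, -, hv1, hv2⟩ := hK _ _ hA hB
    (by
      rintro _ ⟨u, hu, rfl⟩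
      rcases lt_or_ge (π (p u)) (π z) with h | h
      · exact Or.inl h
      · exact Or.inr ⟨h, hne u hu⟩)
    ⟨x, ⟨s, left_mem_uIcc, rfl⟩, by
      have := dist_pos.2 hxz
      simp only [π, mem_ofPred_eq, dist_self]; linarith⟩
    ⟨y, ⟨t, right_mem_uIcc, rfl⟩, by
      have := dist_pos.2 hyz
      have e2 := dist_comm z y
      simp only [π, mem_ofPred_eq, dist_self]
      exact ⟨by linarith, hyz⟩⟩
  exact absurd hv1 (not_lt.2 hv2.1)

theorem FourPoint.range_arc (h4 : FourPoint T)
    (hmid : ∀ (x y : T) (r : ℝ), 0 ≤ r → r ≤ dist x y →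
      ∃ z, dist x z = r ∧ dist z y = dist x y - r)
    {p : unitInterval → T} (hp : Continuous p) (hinj : Function.Injective p) :
    range p = {z | dist (p 0) z + dist z (p 1) = dist (p 0) (p 1)} := by
  ext w
  constructor
  · rintro ⟨t, rfl⟩
    set x := p 0
    set y := p 1
    set w := p t with hw
    have t1 := dist_triangle x w y
    have t2 := dist_triangle w x y
    have t3 := dist_triangle x y w
    have e1 := dist_comm w x
    have e2 := dist_comm w y
    obtain ⟨m, hm1, hm2⟩ := hmid x y ((dist x w + dist x y - dist w y) / 2)
      (by linarith) (by linarith)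
    have e3 := dist_comm m y
    have e4 := dist_comm m w
    have t4 := dist_triangle x m w
    have t5 := dist_triangle w m y
    have hd : dist m w ≤ (dist x w + dist w y - dist x y) / 2 := by
      rcases h4 x y m w with k | k <;> linarith
    obtain ⟨u, hu, hu'⟩ := h4.exists_path_eq hp (s := 0) (t := t) (z := m) (by
      change dist x m + dist m w = dist x w
      linarith)
    obtain ⟨v, hv, hv'⟩ := h4.exists_path_eq hp (s := t) (t := 1) (z := m) (by
      change dist w m + dist m y = dist w y
      linarith)
    rw [uIcc_of_le unitInterval.nonneg'] at hu
    rw [uIcc_of_le unitInterval.le_one'] at hv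
    have huv : u = v := hinj (hu'.trans hv'.symm)
    have hut : u = t := le_antisymm hu.2 (huv ▸ hv.1)
    have hwm : w = m := by rw [hw, ← hut, hu']
    change dist x w + dist w y = dist x y
    rw [hwm]; linarith
  · intro hz
    obtain ⟨u, -, hu⟩ := h4.exists_path_eq hp hz
    exact ⟨u, hu⟩

theorem FourPoint.exists_geodesic (h4 : FourPoint T)
    (hmid : ∀ (x y : T) (r : ℝ), 0 ≤ r → r ≤ dist x y →
      ∃ z, dist x z = r ∧ dist z y = dist x y - r) (x y : T) :
    ∃ γ : ℝ → T, γ 0 = x ∧ γ (dist x y) = y ∧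
      ∀ s ∈ Set.Icc (0:ℝ) (dist x y), ∀ t ∈ Set.Icc (0:ℝ) (dist x y),
        dist (γ s) (γ t) = |s - t| := by
  have : ∀ r : ℝ, ∃ z, r ∈ Icc (0:ℝ) (dist x y) → dist x z = r ∧ dist z y = dist x y - r := by
    intro r
    by_cases hr : r ∈ Icc (0:ℝ) (dist x y)
    · obtain ⟨z, hz⟩ := hmid x y r hr.1 hr.2
      exact ⟨z, fun _ => hz⟩
    · exact ⟨x, fun h => absurd h hr⟩
  choose g hg using this
  refine ⟨g, ?_, ?_, fun s hs t ht => ?_⟩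
  · exact (dist_eq_zero.1 (hg 0 ⟨le_rfl, dist_nonneg⟩).1).symm
  · exact dist_eq_zero.1 (by rw [(hg _ ⟨dist_nonneg, le_rfl⟩).2, sub_self])
  · have h1 := hg s hs
    have h2 := hg t ht
    rw [h4.dist_between (x := x) (y := y) (by linarith) (by linarith), h1.1, h2.1]

theorem FourPoint.isRTree [Nonempty T] (h4 : FourPoint T)
    (hmid : ∀ (x y : T) (r : ℝ), 0 ≤ r → r ≤ dist x y →
      ∃ z, dist x z = r ∧ dist z y = dist x y - r) : IsRTree T where
  nonempty := inferInstance
  geodesic := h4.exists_geodesic hmid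
  uniquelyArcwise := by
    intro p q hp hq hpi hqi h0 h1
    rw [h4.range_arc hmid hp hpi, h4.range_arc hmid hq hqi, h0, h1]
  locallyArcwise := by
    refine LocallyPathConnectedSpace.of_bases (fun x => Metric.nhds_basis_ball) ?_
    intro x r hr
    refine ⟨x, Metric.mem_ball_self hr, fun {y} hy => ?_⟩
    obtain ⟨g, g0, g1, hg⟩ := h4.exists_geodesic hmid x y
    rw [Metric.mem_ball, dist_comm] at hy
    have hD : (0:ℝ) ≤ dist x y := dist_nonneg
    have hmem : ∀ t : unitInterval, dist x y * t ∈ Icc (0:ℝ) (dist x y) := fun t =>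
      ⟨mul_nonneg hD t.2.1, mul_le_of_le_one_right hD t.2.2⟩
    have hcont : ContinuousOn g (Icc (0:ℝ) (dist x y)) := by
      refine LipschitzOnWith.continuousOn (K := 1) (LipschitzOnWith.of_dist_le_mul ?_)
      intro s hs t ht
      rw [hg s hs t ht, Real.dist_eq]; simp
    refine ⟨⟨⟨fun t => g (dist x y * t), ?_⟩, ?_, ?_⟩, ?_⟩
    · exact hcont.comp_continuous (by fun_prop) hmem
    · simp [g0]
    · simp [g1]
    · intro t
      change dist (g (dist x y * t)) x < r
      have := hg _ (hmem t) 0 ⟨le_rfl, hD⟩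
      rw [g0] at this
      rw [this, sub_zero, abs_of_nonneg (hmem t).1]
      exact lt_of_le_of_lt (hmem t).2 hy

end FourPoint

theorem exists_exit_point {W : Set unitInterval} (hW : IsOpen W) {x y : unitInterval}
    (hx : x ∈ W) (hy : y ∉ W) :
    ∃ b ∈ uIcc x y, b ∉ W ∧ (∀ z ∈ uIcc x b, z ≠ b → z ∈ W) ∧
      b ∈ closure {z | z ∈ uIcc x b ∧ uIcc x z ⊆ W} := by
  have hcl : IsClosed Wᶜ := hW.isClosed_compl
  rcases le_total x y with hxy | hxy
  · obtain ⟨b, ⟨hb, hbW⟩, hleast⟩ := (isCompact_Icc.inter_right hcl).exists_isLeast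
      ⟨y, (⟨hxy, le_rfl⟩ : y ∈ Icc x y), hy⟩
    have hxb : x < b := lt_of_le_of_ne hb.1 (fun h => hbW (h ▸ hx))
    have key : ∀ z, x ≤ z → z < b → z ∈ W := fun z h1 h2 => by
      by_contra hz
      exact absurd (hleast ⟨⟨h1, h2.le.trans hb.2⟩, hz⟩) (not_le.2 h2)
    refine ⟨b, by rwa [uIcc_of_le hxy], hbW, ?_, ?_⟩
    · rw [uIcc_of_le hxb.le]
      exact fun z hz hne => key z hz.1 (lt_of_le_of_ne hz.2 hne)
    · have : b ∈ closure (Ico x b) := by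
        rw [closure_Ico hxb.ne]; exact ⟨hxb.le, le_rfl⟩
      refine closure_mono ?_ this
      rintro z ⟨h1, h2⟩
      refine ⟨by rw [uIcc_of_le hxb.le]; exact ⟨h1, h2.le⟩, ?_⟩
      rw [uIcc_of_le h1]
      exact fun u hu => key u hu.1 (lt_of_le_of_lt hu.2 h2)
  · obtain ⟨b, ⟨hb, hbW⟩, hgreatest⟩ := (isCompact_Icc.inter_right hcl).exists_isGreatest
      ⟨y, (⟨le_rfl, hxy⟩ : y ∈ Icc y x), hy⟩
    have hxb : b < x := lt_of_le_of_ne hb.2 (fun h => hbW (h ▸ hx))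
    have key : ∀ z, z ≤ x → b < z → z ∈ W := fun z h1 h2 => by
      by_contra hz
      exact absurd (hgreatest ⟨⟨hb.1.trans h2.le, h1⟩, hz⟩) (not_le.2 h2)
    refine ⟨b, by rwa [uIcc_of_ge hxy], hbW, ?_, ?_⟩
    · rw [uIcc_of_ge hxb.le]
      exact fun z hz hne => key z hz.2 (lt_of_le_of_ne hz.1 hne.symm)
    · have : b ∈ closure (Ioc b x) := by
        rw [closure_Ioc hxb.ne]; exact ⟨le_rfl, hxb.le⟩
      refine closure_mono ?_ this
      rintro z ⟨h1, h2⟩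
      refine ⟨by rw [uIcc_of_ge hxb.le]; exact ⟨h1.le, h2⟩, ?_⟩
      rw [uIcc_of_ge h2]
      exact fun u hu => key u hu.2 (lt_of_lt_of_le h1 hu.1)

section TreeCode

/-- The minimum of `h` on the interval spanned by `s` and `t`. -/
noncomputable def treeMin (h : C(unitInterval, ℝ)) (s t : unitInterval) : ℝ := sInf (h '' uIcc s t)

variable (h : C(unitInterval, ℝ))

theorem exists_treeMin_eq (s t : unitInterval) : ∃ z ∈ uIcc s t, h z = treeMin h s t := by
  obtain ⟨z, hz, hz'⟩ := isCompact_uIcc.exists_sInf_image_eq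
    (nonempty_uIcc (a := s) (b := t)) h.continuous.continuousOn
  exact ⟨z, hz, hz'.symm⟩

theorem treeMin_le {s t z : unitInterval} (hz : z ∈ uIcc s t) : treeMin h s t ≤ h z :=
  csInf_le (isCompact_uIcc.image h.continuous).bddBelow ⟨z, hz, rfl⟩

theorem treeMin_comm (s t : unitInterval) : treeMin h s t = treeMin h t s := by
  rw [treeMin, treeMin, uIcc_comm]

theorem treeMin_self (s : unitInterval) : treeMin h s s = h s := by
  simp [treeMin]

theorem treeMin_ultra (s t u : unitInterval) :
    treeMin h s u ≤ treeMin h s t ∨ treeMin h u t ≤ treeMin h s t := by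
  obtain ⟨z, hz, hz'⟩ := exists_treeMin_eq h s t
  rw [← hz']
  rcases uIcc_subset_uIcc_union_uIcc (b := u) hz with hz | hz
  · exact Or.inl (treeMin_le h hz)
  · exact Or.inr (treeMin_le h hz)

/-- The unit interval with the pseudometric `h s + h t - 2 min_{[s,t]} h` of the real tree
coded by the function `h`. -/
def TreeCode (_h : C(unitInterval, ℝ)) : Type := unitInterval

noncomputable instance : PseudoMetricSpace (TreeCode h) where
  dist (s t : unitInterval) := h s + h t - 2 * treeMin h s t
  dist_self (s : unitInterval) := by
    rw [treeMin_self]; ring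
  dist_comm (s t : unitInterval) := by
    rw [treeMin_comm]; ring
  dist_triangle (s u t : unitInterval) := by
    have h1 := treeMin_le h (right_mem_uIcc : u ∈ uIcc s u)
    have h2 := treeMin_le h (left_mem_uIcc : u ∈ uIcc u t)
    rcases treeMin_ultra h s t u with k | k <;> linarith

/-- The real tree coded by the function `h`. -/
abbrev CodedTree : Type := SeparationQuotient (TreeCode h)

/-- The projection of the unit interval to the coded tree. -/
noncomputable def CodedTree.proj (s : unitInterval) : CodedTree h :=
  SeparationQuotient.mk (X := TreeCode h) s

theorem CodedTree.dist_proj (s t : unitInterval) :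
    dist (CodedTree.proj h s) (CodedTree.proj h t) = h s + h t - 2 * treeMin h s t :=
  SeparationQuotient.dist_mk (α := TreeCode h) s t

theorem CodedTree.surjective_proj : Function.Surjective (CodedTree.proj h) :=
  SeparationQuotient.surjective_mk (X := TreeCode h)

theorem CodedTree.proj_eq_iff {s t : unitInterval} :
    CodedTree.proj h s = CodedTree.proj h t ↔ h s = h t ∧ ∀ z ∈ uIcc s t, h s ≤ h z := by
  rw [← dist_eq_zero, CodedTree.dist_proj]
  have h1 := treeMin_le h (left_mem_uIcc : s ∈ uIcc s t)
  have h2 := treeMin_le h (right_mem_uIcc : t ∈ uIcc s t)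
  constructor
  · intro h0
    refine ⟨by linarith, fun z hz => ?_⟩
    have := treeMin_le h hz
    linarith
  · rintro ⟨he, hmin⟩
    obtain ⟨z, hz, hz'⟩ := exists_treeMin_eq h s t
    have := hmin z hz
    linarith

theorem CodedTree.continuous_proj : Continuous (CodedTree.proj h) := by
  rw [continuous_iff_continuousAt]
  intro t
  rw [ContinuousAt, Metric.tendsto_nhds]
  intro ε hε
  have hN : {z | |h z - h t| < ε / 4} ∈ 𝓝 t :=
    (isOpen_lt (by fun_prop) continuous_const).mem_nhds (by simp; linarith)
  obtain ⟨a, b, ht, hab, hsub⟩ := exists_Icc_mem_subset_of_mem_nhds hN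
  filter_upwards [hab] with s hs
  rw [CodedTree.dist_proj]
  obtain ⟨z, hz, hz'⟩ := exists_treeMin_eq h s t
  have h1 : |h z - h t| < ε / 4 := hsub (ordConnected_Icc.uIcc_subset hs ht hz)
  have h2 : |h s - h t| < ε / 4 := hsub hs
  rw [abs_lt] at h1 h2
  rw [← hz']
  linarith [h1.1, h2.2]

theorem CodedTree.fourPoint : FourPoint (CodedTree h) := by
  intro x y z w
  obtain ⟨x, rfl⟩ := CodedTree.surjective_proj h x
  obtain ⟨y, rfl⟩ := CodedTree.surjective_proj h y
  obtain ⟨z, rfl⟩ := CodedTree.surjective_proj h z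
  obtain ⟨w, rfl⟩ := CodedTree.surjective_proj h w
  simp only [CodedTree.dist_proj]
  by_contra! hc
  obtain ⟨c1, c2⟩ := hc
  have k1 := treeMin_ultra h x y z
  have k2 := treeMin_ultra h x y w
  have k3 := treeMin_ultra h z w x
  have k4 := treeMin_ultra h z w y
  rw [treeMin_comm h z y] at k1
  rw [treeMin_comm h w y] at k2
  rw [treeMin_comm h z x] at k3
  rw [treeMin_comm h z y] at k4
  rcases k1 with k1 | k1 <;> rcases k2 with k2 | k2 <;> rcases k3 with k3 | k3 <;>
    rcases k4 with k4 | k4 <;> linarith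

theorem exists_level_point {s t : unitInterval} {a : ℝ} (ha : treeMin h s t ≤ a) (has : a ≤ h s) :
    ∃ u ∈ uIcc s t, h u = a ∧ treeMin h s u = a := by
  suffices ∃ u ∈ uIcc s t, h u = a ∧ ∀ v ∈ uIcc s u, a ≤ h v by
    obtain ⟨u, hu, hua, hmin⟩ := this
    refine ⟨u, hu, hua, le_antisymm (hua ▸ treeMin_le h right_mem_uIcc) ?_⟩
    obtain ⟨z, hz, hz'⟩ := exists_treeMin_eq h s u
    exact hz' ▸ hmin z hz
  rcases has.eq_or_lt with rfl | hlt
  · exact ⟨s, left_mem_uIcc, rfl, by simp⟩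
  obtain ⟨z, hz, hz'⟩ := exists_treeMin_eq h s t
  obtain ⟨b, hb, hbW, hpre, hbcl⟩ := exists_exit_point (W := {v | a < h v})
    (isOpen_lt continuous_const h.continuous) (x := s) (y := z) hlt (by simp; linarith)
  have hab : a ≤ h b := by
    have hclosed : IsClosed {v | a ≤ h v} := isClosed_le continuous_const h.continuous
    refine closure_minimal ?_ hclosed hbcl
    rintro v ⟨-, hv⟩
    have : a < h v := hv right_mem_uIcc
    exact this.le
  refine ⟨b, uIcc_subset_uIcc_left hz hb, le_antisymm (not_lt.1 hbW) hab, fun v hv => ?_⟩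
  by_cases hvb : v = b
  · rwa [hvb]
  · have : a < h v := hpre v hv hvb
    exact this.le

theorem CodedTree.exists_between (x y : CodedTree h) (r : ℝ) (hr : 0 ≤ r) (hr' : r ≤ dist x y) :
    ∃ z, dist x z = r ∧ dist z y = dist x y - r := by
  obtain ⟨s, rfl⟩ := CodedTree.surjective_proj h x
  obtain ⟨t, rfl⟩ := CodedTree.surjective_proj h y
  have aux : ∀ (s t : unitInterval) (r : ℝ), 0 ≤ r → r ≤ h s - treeMin h s t →
      ∃ u, dist (CodedTree.proj h s) (CodedTree.proj h u) = r ∧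
        dist (CodedTree.proj h u) (CodedTree.proj h t) =
          dist (CodedTree.proj h s) (CodedTree.proj h t) - r := by
    intro s t r h0 h1
    obtain ⟨u, hu, hua, hum⟩ := exists_level_point h (s := s) (t := t) (a := h s - r)
      (by linarith) (by linarith)
    refine ⟨u, ?_, ?_⟩
    · rw [CodedTree.dist_proj]; linarith
    · have h2 : treeMin h s t ≤ treeMin h u t := by
        obtain ⟨z, hz, hz'⟩ := exists_treeMin_eq h u t
        exact hz' ▸ treeMin_le h (uIcc_subset_uIcc_right hu hz)
      have h3 := treeMin_le h (left_mem_uIcc : u ∈ uIcc u t)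
      have h4 : treeMin h u t = treeMin h s t := by
        rcases treeMin_ultra h s t u with k | k <;> linarith
      rw [CodedTree.dist_proj, CodedTree.dist_proj]; linarith
  rcases le_total r (h s - treeMin h s t) with hle | hle
  · obtain ⟨u, hu⟩ := aux s t r hr hle
    exact ⟨_, hu⟩
  · have hd := CodedTree.dist_proj h s t
    obtain ⟨u, hu1, hu2⟩ := aux t s (dist (CodedTree.proj h s) (CodedTree.proj h t) - r)
      (by linarith) (by rw [treeMin_comm]; linarith)
    refine ⟨CodedTree.proj h u, ?_, ?_⟩
    · rw [dist_comm, hu2, dist_comm (CodedTree.proj h t)]; ring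
    · rw [dist_comm, hu1]

/-- A loop factors through a real tree as soon as some height function codes it. -/
theorem exists_rTree_factorization {X : Type*} [TopologicalSpace X] {L : unitInterval → X}
    (hL : Continuous L)
    (hcode : ∀ s t, h s = h t → (∀ z ∈ uIcc s t, h s ≤ h z) → L s = L t)
    (h01 : h 0 = h 1) (hmin : ∀ z, h 0 ≤ h z) :
    ∃ (T : Type) (_ : MetricSpace T), IsRTree T ∧
      ∃ (f : T → X) (ℓ : unitInterval → T),
        Continuous f ∧ Continuous ℓ ∧ ℓ 0 = ℓ 1 ∧ f ∘ ℓ = L := by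
  have : Nonempty (CodedTree h) := ⟨CodedTree.proj h 0⟩
  have hfac : (L ∘ Function.surjInv (CodedTree.surjective_proj h)) ∘ CodedTree.proj h = L := by
    funext s
    have := (CodedTree.proj_eq_iff h).1
      (Function.surjInv_eq (CodedTree.surjective_proj h) (CodedTree.proj h s))
    exact hcode _ _ this.1 this.2
  have hquot : IsQuotientMap (CodedTree.proj h) :=
    (CodedTree.continuous_proj h).isClosedMap.isQuotientMap (CodedTree.continuous_proj h)
      (CodedTree.surjective_proj h)
  exact ⟨CodedTree h, inferInstance, (CodedTree.fourPoint h).isRTree (CodedTree.exists_between h),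
    L ∘ Function.surjInv (CodedTree.surjective_proj h), CodedTree.proj h,
    hquot.continuous_iff.2 (by rwa [hfac]), CodedTree.continuous_proj h,
    (CodedTree.proj_eq_iff h).2 ⟨h01, fun z _ => hmin z⟩, hfac⟩

end TreeCode

/-- A monotone height function on the domain of a path which is constant on exactly those
intervals on which the path is constant. -/
theorem exists_path_height {X : Type*} [MetricSpace X] {α : unitInterval → X}
    (hα : Continuous α) :
    ∃ c : unitInterval → ℝ, Continuous c ∧ c 0 = 0 ∧ (∀ x, 0 ≤ c x) ∧ (∀ x, c x ≤ 1) ∧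
      (∀ x y, c x = c y → ∀ z ∈ uIcc x y, α z = α x) ∧
      (∀ x y, (∀ z ∈ uIcc x y, α z = α x) → c x = c y) := by
  let q : ℕ → unitInterval := TopologicalSpace.denseSeq unitInterval
  have hq : DenseRange q := TopologicalSpace.denseRange_denseSeq unitInterval
  let φ : ℕ → unitInterval → ℝ := fun n y => min 1 (dist (α (max y (q n))) (α (q n)))
  have hφc : ∀ n, Continuous (φ n) := fun n => by fun_prop
  have hφ0 : ∀ n y, 0 ≤ φ n y := fun n y => le_min zero_le_one dist_nonneg
  have hφ1 : ∀ n y, φ n y ≤ 1 := fun n y => min_le_left _ _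
  have hφz : ∀ n y, y ≤ q n → φ n y = 0 := fun n y hy => by
    simp [φ, max_eq_right hy]
  let g : ℕ → unitInterval → ℝ := fun n x => sSup ((fun y => φ n (min x y)) '' univ)
  have hgc : ∀ n, Continuous (g n) := fun n =>
    isCompact_univ.continuous_sSup (f := fun x y => φ n (min x y))
      ((hφc n).comp (continuous_fst.min continuous_snd))
  have hbdd : ∀ n x, BddAbove ((fun y => φ n (min x y)) '' univ) := fun n x =>
    ⟨1, by rintro _ ⟨y, -, rfl⟩; exact hφ1 _ _⟩
  have hle : ∀ n x y, y ≤ x → φ n y ≤ g n x := fun n x y hyx =>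
    le_csSup (hbdd n x) ⟨y, mem_univ _, by simp only [min_eq_right hyx]⟩
  have hge : ∀ n x a, (∀ y ≤ x, φ n y ≤ a) → g n x ≤ a := fun n x a ha =>
    csSup_le (univ_nonempty.image _) (by rintro _ ⟨y, -, rfl⟩; exact ha _ (min_le_left _ _))
  have hg0 : ∀ n x, 0 ≤ g n x := fun n x => (hφ0 n x).trans (hle n x x le_rfl)
  have hg1 : ∀ n x, g n x ≤ 1 := fun n x => hge n x 1 fun y _ => hφ1 n y
  have hgm : ∀ n, Monotone (g n) := fun n x y hxy =>
    hge n x _ fun z hz => hle n y z (hz.trans hxy)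
  obtain ⟨w, hw, a, hwa, ha⟩ := posSumOfEncodable (zero_lt_one (α := ℝ)) ℕ
  have hterm0 : ∀ n x, 0 ≤ w n * g n x := fun n x => mul_nonneg (hw n).le (hg0 n x)
  have hterm1 : ∀ n x, w n * g n x ≤ w n := fun n x =>
    mul_le_of_le_one_right (hw n).le (hg1 n x)
  have hsum : ∀ x, Summable fun n => w n * g n x := fun x =>
    Summable.of_nonneg_of_le (fun n => hterm0 n x) (fun n => hterm1 n x) hwa.summable
  refine ⟨fun x => ∑' n, w n * g n x, ?_, ?_, ?_, ?_, ?_, ?_⟩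
  · refine continuous_tsum (fun n => continuous_const.mul (hgc n)) hwa.summable fun n x => ?_
    rw [Real.norm_of_nonneg (hterm0 n x)]
    exact hterm1 n x
  · have : ∀ n, g n 0 = 0 := fun n => le_antisymm
      (hge n 0 0 fun y hy => (hφz n y (hy.trans unitInterval.nonneg')).le) (hg0 n 0)
    simp [this]
  · exact fun x => tsum_nonneg fun n => hterm0 n x
  · exact fun x => ((hsum x).tsum_le_tsum (fun n => hterm1 n x) hwa.summable).trans
      (hwa.tsum_eq.le.trans ha)
  · have aux : ∀ x y, x ≤ y → (∑' n, w n * g n x = ∑' n, w n * g n y) →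
        ∀ z ∈ Icc x y, α z = α x := by
      intro x y hxy hc z hz
      have heq : ∀ n, g n x = g n y := by
        intro n
        by_contra hne
        have hlt : g n x < g n y := lt_of_le_of_ne (hgm n hxy) hne
        exact absurd hc (Summable.tsum_lt_tsum (i := n)
          (fun m => mul_le_mul_of_nonneg_left (hgm m hxy) (hw m).le)
          (mul_lt_mul_of_pos_left hlt (hw n)) (hsum x) (hsum y)).ne
      by_contra hne
      have hxz : x < z := lt_of_le_of_ne hz.1 (fun h => hne (by rw [h]))
      have hV : IsOpen {u | α u ≠ α z} := isOpen_ne_fun hα continuous_const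
      have hx : x ∈ closure (Ioo x z) := by
        rw [closure_Ioo hxz.ne]; exact ⟨le_rfl, hxz.le⟩
      obtain ⟨n, hn1, hn2⟩ := hq.exists_mem_open (hV.inter isOpen_Ioo)
        (mem_closure_iff.1 hx _ hV (Ne.symm hne))
      have h1 : g n x ≤ 0 := hge n x 0 fun y hy => (hφz n y (hy.trans hn2.1.le)).le
      have h2 : 0 < φ n z := by
        have : 0 < dist (α z) (α (q n)) := dist_pos.2 (Ne.symm hn1)
        simp only [φ, max_eq_left hn2.2.le]
        exact lt_min zero_lt_one this
      have h3 := hle n y z hz.2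
      have h4 := heq n
      linarith
    intro x y hc z hz
    rcases le_total x y with hxy | hxy
    · exact aux x y hxy hc z (by rwa [uIcc_of_le hxy] at hz)
    · rw [uIcc_of_ge hxy] at hz
      rw [aux y x hxy hc.symm z hz, aux y x hxy hc.symm x ⟨hxy, le_rfl⟩]
  · have aux : ∀ x y, x ≤ y → (∀ z ∈ Icc x y, α z = α x) → ∀ n, g n x = g n y := by
      intro x y hxy hc n
      refine le_antisymm (hgm n hxy) (hge n y _ fun v hv => ?_)
      rcases le_or_gt v x with hvx | hvx
      · exact hle n x v hvx
      rcases le_or_gt (q n) x with hqx | hqx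
      · refine le_trans (le_of_eq ?_) (hle n x x le_rfl)
        simp only [φ, max_eq_left hqx, max_eq_left (hqx.trans hvx.le), hc v ⟨hvx.le, hv⟩]
      · refine le_trans (le_of_eq ?_) (hg0 n x)
        rcases le_or_gt (q n) v with hqv | hqv
        · simp [φ, max_eq_left hqv, hc v ⟨hvx.le, hv⟩, hc (q n) ⟨hqx.le, hqv.trans hv⟩]
        · exact hφz n v hqv.le
    intro x y hc
    rcases le_total x y with hxy | hxy
    · rw [uIcc_of_le hxy] at hc
      simp only [aux x y hxy hc]
    · rw [uIcc_of_ge hxy] at hc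
      have hc' : ∀ z ∈ Icc y x, α z = α y := fun z hz => by
        rw [hc z hz, hc y ⟨le_rfl, hxy⟩]
      simp only [aux y x hxy hc']

section Halves

/-- The increasing affine map of `[0,1]` onto `[0,1/2]`. -/
noncomputable def leftHalf (u : unitInterval) : unitInterval :=
  ⟨u / 2, by have := u.2.1; linarith, by have := u.2.2; linarith⟩

/-- The decreasing affine map of `[0,1]` onto `[1/2,1]`. -/
noncomputable def rightHalf (u : unitInterval) : unitInterval :=
  ⟨1 - u / 2, by have := u.2.2; linarith, by have := u.2.1; linarith⟩

theorem continuous_leftHalf : Continuous leftHalf := by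
  unfold leftHalf; fun_prop

theorem leftHalf_zero : leftHalf 0 = 0 := Subtype.ext (by simp [leftHalf])

theorem rightHalf_zero : rightHalf 0 = 1 := Subtype.ext (by simp [rightHalf])

theorem antitone_rightHalf : Antitone rightHalf := fun u v huv => by
  have : (u : ℝ) ≤ v := huv
  change 1 - (v : ℝ) / 2 ≤ 1 - (u : ℝ) / 2
  linarith

theorem leftHalf_le_rightHalf (u v : unitInterval) : leftHalf u ≤ rightHalf v := by
  have := u.2.2
  have := v.2.2
  change (u : ℝ) / 2 ≤ 1 - (v : ℝ) / 2
  linarith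

theorem eq_leftHalf_or_eq_rightHalf (t : unitInterval) :
    (∃ u, t = leftHalf u) ∨ ∃ u, t = rightHalf u := by
  have h0 := t.2.1
  have h1 := t.2.2
  rcases le_total (t : ℝ) (1 / 2) with h | h
  · exact Or.inl ⟨⟨2 * t, by linarith, by linarith⟩, Subtype.ext (by simp [leftHalf])⟩
  · exact Or.inr ⟨⟨2 - 2 * t, by linarith, by linarith⟩,
      Subtype.ext (by simp only [rightHalf]; ring)⟩

variable {X : Type*} {α β : unitInterval → X}

theorem concatReverse_leftHalf (u : unitInterval) : ConcatReverse α β (leftHalf u) = α u := by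
  have h : ((leftHalf u : unitInterval) : ℝ) ≤ 1 / 2 := by
    have := u.2.2
    change (u : ℝ) / 2 ≤ 1 / 2
    linarith
  have h2 : 2 * ((leftHalf u : unitInterval) : ℝ) = u := by
    change 2 * ((u : ℝ) / 2) = u
    ring
  rw [ConcatReverse, if_pos h, h2, projIcc_val]

theorem pathConcat_leftHalf (u : unitInterval) : PathConcat α β (leftHalf u) = α u := by
  have h : ((leftHalf u : unitInterval) : ℝ) ≤ 1 / 2 := by
    have := u.2.2
    change (u : ℝ) / 2 ≤ 1 / 2
    linarith
  rw [← concatReverse_leftHalf (α := α) (β := β) u, PathConcat, ConcatReverse, if_pos h, if_pos h]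

theorem concatReverse_rightHalf (h1 : α 1 = β 1) (u : unitInterval) :
    ConcatReverse α β (rightHalf u) = β u := by
  by_cases hu : u = 1
  · subst hu
    have : rightHalf 1 = leftHalf 1 :=
      Subtype.ext (by norm_num [rightHalf, leftHalf])
    rw [this, concatReverse_leftHalf, h1]
  · have hu' : (u : ℝ) < 1 := lt_of_le_of_ne u.2.2 fun h => hu (Subtype.ext h)
    have h : ¬ ((rightHalf u : unitInterval) : ℝ) ≤ 1 / 2 := by
      change ¬ 1 - (u : ℝ) / 2 ≤ 1 / 2
      linarith
    have h2 : 2 - 2 * ((rightHalf u : unitInterval) : ℝ) = u := by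
      change 2 - 2 * (1 - (u : ℝ) / 2) = u
      ring
    rw [ConcatReverse, if_neg h, h2, projIcc_val]

theorem continuous_concatReverse [TopologicalSpace X] (hα : Continuous α) (hβ : Continuous β)
    (h1 : α 1 = β 1) : Continuous (ConcatReverse α β) := by
  unfold ConcatReverse
  refine Continuous.if_le (hα.comp (continuous_projIcc.comp (by fun_prop)))
    (hβ.comp (continuous_projIcc.comp (by fun_prop))) (by fun_prop) continuous_const ?_
  intro t ht
  rw [ht]
  norm_num
  exact h1

end Halves

section InversePair

/-- The map folding `[0,1]` at its midpoint onto `[0,1]`. -/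
noncomputable def foldMap (t : unitInterval) : unitInterval :=
  projIcc (0:ℝ) 1 zero_le_one (min (2 * (t : ℝ)) (2 - 2 * t))

theorem continuous_foldMap : Continuous foldMap :=
  continuous_projIcc.comp (by fun_prop)

theorem concatReverse_self {X : Type*} (α : unitInterval → X) (t : unitInterval) :
    ConcatReverse α α t = α (foldMap t) := by
  unfold ConcatReverse foldMap
  split_ifs with h
  · rw [min_eq_left (by linarith)]
  · rw [min_eq_right (by linarith)]

theorem foldMap_zero : foldMap 0 = 0 := by
  simp [foldMap]

theorem foldMap_one : foldMap 1 = 0 := by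
  simp [foldMap]

theorem eq_zero_or_one_of_foldMap {t : unitInterval} (h : foldMap t = 0) : t = 0 ∨ t = 1 := by
  have h0 := t.2.1
  have h1 := t.2.2
  rcases projIcc_eq_left (zero_lt_one (α := ℝ)) |>.1 h |> min_le_iff.1 with h | h
  · exact Or.inl (Subtype.ext (by change (t : ℝ) = 0; linarith))
  · exact Or.inr (Subtype.ext (by change (t : ℝ) = 1; linarith))

theorem StrictMono.unitInterval_map_zero {h : unitInterval ≃ₜ unitInterval}
    (hm : StrictMono h) : h 0 = 0 :=
  le_antisymm (by
    have := hm.monotone (unitInterval.nonneg' : 0 ≤ h.symm 0)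
    rwa [h.apply_symm_apply] at this) unitInterval.nonneg'

theorem StrictMono.unitInterval_map_one {h : unitInterval ≃ₜ unitInterval}
    (hm : StrictMono h) : h 1 = 1 :=
  le_antisymm unitInterval.le_one' (by
    have := hm.monotone (unitInterval.le_one' : h.symm 1 ≤ 1)
    rwa [h.apply_symm_apply] at this)

variable {X : Type*}

theorem IsCantorPath.exists_ne_of_mem_nhds [TopologicalSpace X] {α : unitInterval → X}
    (hα : IsCantorPath α) {U : Set unitInterval} (hU : U ∈ 𝓝 0) : ∃ z ∈ U, α z ≠ α 0 := by
  by_contra! hc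
  have : (0:ℝ) ∈ Oset α := ⟨unitInterval.zero_mem, U, hU, hc⟩
  exact lt_irrefl _ (hα.2.2.2.1 this).1

/-- A height function for an inverse-pair loop: positive inside, with level sets and
intervals of constancy matching those of the loop. -/
theorem IsCIPLoop.exists_height [MetricSpace X] {ℓ : unitInterval → X} (hℓ : Continuous ℓ)
    (h : IsCIPLoop ℓ) :
    ∃ η : unitInterval → ℝ, Continuous η ∧ η 0 = 0 ∧ η 1 = 0 ∧ (∀ t, 0 ≤ η t) ∧
      (∀ t, η t ≤ 1) ∧ (∀ t, t ≠ 0 → t ≠ 1 → 0 < η t) ∧ (∀ s t, η s = η t → ℓ s = ℓ t) ∧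
      (∀ s t, (∀ u ∈ uIcc s t, ℓ u = ℓ s) → η s = η t) := by
  obtain ⟨α, h, hm, hfac, hα⟩ := h
  have hfac' : ∀ t, ℓ (h t) = α (foldMap t) := fun t => by
    rw [← concatReverse_self α, ← hfac]; rfl
  have hℓ' : ∀ s, ℓ s = α (foldMap (h.symm s)) := fun s => by
    rw [← hfac', h.apply_symm_apply]
  have hαc : Continuous α := by
    have : α = fun u => ℓ (h (leftHalf u)) := by
      funext u
      rw [← concatReverse_leftHalf (α := α) (β := α) u, ← hfac]; rfl
    rw [this]
    exact hℓ.comp (h.continuous.comp continuous_leftHalf)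
  have hne : ∀ v : unitInterval, v ≠ 0 → ∃ z ∈ uIcc 0 v, α z ≠ α 0 := by
    intro v hv
    have hv0 : 0 < v := unitInterval.pos_iff_ne_zero.2 hv
    rw [uIcc_of_le hv0.le]
    rcases hα with hα | ⟨α₁, x, h', hm', hα₁, hfac₁⟩
    · obtain ⟨z, hz, hzα⟩ := hα.exists_ne_of_mem_nhds (Iio_mem_nhds hv0)
      exact ⟨z, ⟨unitInterval.nonneg', le_of_lt hz⟩, hzα⟩
    · have e : ∀ u, α₁ u = α (h' (leftHalf u)) := fun u => by
        rw [← pathConcat_leftHalf (α := α₁) (β := fun _ => x) u, ← hfac₁]; rfl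
      have hU : IsOpen {u | h' (leftHalf u) < v} :=
        isOpen_lt (h'.continuous.comp continuous_leftHalf) continuous_const
      obtain ⟨z, hz, hzα⟩ := hα₁.exists_ne_of_mem_nhds (hU.mem_nhds (by
        change h' (leftHalf 0) < v
        rwa [leftHalf_zero, hm'.unitInterval_map_zero]))
      rw [e, e, leftHalf_zero, hm'.unitInterval_map_zero] at hzα
      exact ⟨_, ⟨unitInterval.nonneg', le_of_lt hz⟩, hzα⟩
  obtain ⟨c, hcc, hc0, hcnn, hc1, hcode, hconst⟩ := exists_path_height hαc
  have hs0 : h.symm 0 = 0 := by rw [h.symm_apply_eq, hm.unitInterval_map_zero]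
  have hs1 : h.symm 1 = 1 := by rw [h.symm_apply_eq, hm.unitInterval_map_one]
  refine ⟨fun s => c (foldMap (h.symm s)),
    hcc.comp (continuous_foldMap.comp h.symm.continuous), ?_, ?_, fun _ => hcnn _,
    fun _ => hc1 _, ?_, ?_, ?_⟩
  · simp only [hs0, foldMap_zero, hc0]
  · simp only [hs1, foldMap_one, hc0]
  · intro t ht0 ht1
    refine lt_of_le_of_ne (hcnn _) fun h0 => ?_
    have hfold : foldMap (h.symm t) ≠ 0 := by
      intro hf
      rcases eq_zero_or_one_of_foldMap hf with hf | hf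
      · exact ht0 (by rw [← h.apply_symm_apply t, hf, hm.unitInterval_map_zero])
      · exact ht1 (by rw [← h.apply_symm_apply t, hf, hm.unitInterval_map_one])
    obtain ⟨z, hz, hzα⟩ := hne _ hfold
    exact hzα (hcode _ _ (hc0.trans h0) z hz)
  · intro s t hst
    rw [hℓ', hℓ', hcode _ _ hst _ right_mem_uIcc]
  · intro s t hst
    refine hconst _ _ fun z hz => ?_
    obtain ⟨a, ha, rfl⟩ := intermediate_value_uIcc continuous_foldMap.continuousOn hz
    have : h a ∈ uIcc s t := by
      have := hm.monotone.mapsTo_uIcc ha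
      rwa [h.apply_symm_apply, h.apply_symm_apply] at this
    rw [← hfac', ← hℓ', hst _ this]

end InversePair

/-- `γ'` arises from `γ` by inserting loops over the components of `W`, and `e` is a height
function for the inserted loops. -/
structure LoopInsertion {X : Type*} (γ γ' : unitInterval → X) (W : Set unitInterval)
    (e : unitInterval → ℝ) : Prop where
  isOpen : IsOpen W
  zero_notMem : 0 ∉ W
  one_notMem : 1 ∉ W
  continuous_height : Continuous e
  height_pos : ∀ x ∈ W, 0 < e x
  height_eq_zero : ∀ x ∉ W, e x = 0
  const : ∀ x y, uIcc x y ⊆ W → γ x = γ y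
  eq_off : ∀ x ∉ W, γ' x = γ x
  code : ∀ x y, uIcc x y ⊆ W → e x = e y → γ' x = γ' y
  height_const : ∀ x y, uIcc x y ⊆ W → (∀ z ∈ uIcc x y, γ' z = γ' x) → e x = e y

theorem LoopInsertion.height_nonneg {X : Type*} {γ γ' : unitInterval → X}
    {W : Set unitInterval} {e : unitInterval → ℝ} (h : LoopInsertion γ γ' W e)
    (x : unitInterval) : 0 ≤ e x := by
  by_cases hx : x ∈ W
  · exact (h.height_pos x hx).le
  · exact (h.height_eq_zero x hx).ge

theorem eq_of_uIcc_subset_Oset {X : Type*} [TopologicalSpace X] {α : unitInterval → X}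
    {x y : unitInterval} (h : ∀ z ∈ uIcc x y, (z : ℝ) ∈ Oset α) : α x = α y := by
  refine isPreconnected_uIcc.induction₂ (s := uIcc x y) (fun a b => α a = α b) ?_
    (fun _ _ _ _ _ _ => Eq.trans) (fun _ _ _ _ => Eq.symm) left_mem_uIcc right_mem_uIcc
  intro z hz
  obtain ⟨_, U, hU, hUc⟩ := h z hz
  filter_upwards [mem_nhdsWithin_of_mem_nhds hU] with u hu
  exact (hUc u hu).symm

theorem IsConnected.eq_Ioo_of_isOpen {J : Set ℝ} (hc : IsConnected J) (ho : IsOpen J)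
    (hb : BddBelow J) (ha : BddAbove J) : J = Ioo (sInf J) (sSup J) := by
  refine Subset.antisymm (fun x hx => ?_) (hc.Ioo_csInf_csSup_subset hb ha)
  obtain ⟨a, b, hab, hsub⟩ : ∃ a b, x ∈ Ioo a b ∧ Icc a b ⊆ J := by
    obtain ⟨ε, hε, hball⟩ := Metric.isOpen_iff.1 ho x hx
    refine ⟨x - ε / 2, x + ε / 2, ⟨by linarith, by linarith⟩, fun z hz => hball ?_⟩
    rw [Metric.mem_ball, Real.dist_eq, abs_lt]
    constructor <;> linarith [hz.1, hz.2]
  have hle : a ≤ b := (hab.1.trans hab.2).le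
  exact ⟨(csInf_le hb (hsub ⟨le_rfl, hle⟩)).trans_lt hab.1,
    hab.2.trans_le (le_csSup ha (hsub ⟨hle, le_rfl⟩))⟩

/-- The affine coordinate of `[a,b]`, clamped to `[0,1]`. -/
noncomputable def affineCoord (a b : ℝ) (x : unitInterval) : unitInterval :=
  projIcc (0:ℝ) 1 zero_le_one ((x - a) / (b - a))

theorem continuous_affineCoord (a b : ℝ) : Continuous (affineCoord a b) :=
  continuous_projIcc.comp (by fun_prop)

theorem affineCoord_eq_zero_or_one {a b : ℝ} (hab : a < b) {x : unitInterval}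
    (hx : (x : ℝ) ∉ Ioo a b) : affineCoord a b x = 0 ∨ affineCoord a b x = 1 := by
  have hd : 0 < b - a := sub_pos.2 hab
  rcases le_or_gt (x : ℝ) a with h | h
  · exact Or.inl (projIcc_of_le_left _ (div_nonpos_of_nonpos_of_nonneg (by linarith) hd.le))
  · have hb : b ≤ x := not_lt.1 fun hb => hx ⟨h, hb⟩
    exact Or.inr (projIcc_of_right_le _ ((one_le_div hd).2 (by linarith)))

theorem coe_affineCoord {a b : ℝ} {x : unitInterval} (hx : (x : ℝ) ∈ Ioo a b) :
    (affineCoord a b x : ℝ) = (x - a) / (b - a) := by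
  have hd : 0 < b - a := sub_pos.2 (hx.1.trans hx.2)
  rw [affineCoord, projIcc_of_mem zero_le_one (x := ((x : ℝ) - a) / (b - a))
    ⟨div_nonneg (by linarith [hx.1]) hd.le, (div_le_one hd).2 (by linarith [hx.2])⟩]

theorem affineCoord_ne {a b : ℝ} {x : unitInterval} (hx : (x : ℝ) ∈ Ioo a b) :
    affineCoord a b x ≠ 0 ∧ affineCoord a b x ≠ 1 := by
  have hd : 0 < b - a := sub_pos.2 (hx.1.trans hx.2)
  have h := coe_affineCoord hx
  constructor <;> intro h0 <;> rw [h0] at h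
  · have : 0 < ((x : ℝ) - a) / (b - a) := div_pos (by linarith [hx.1]) hd
    rw [← h] at this
    exact lt_irrefl _ this
  · have : ((x : ℝ) - a) / (b - a) < 1 := (div_lt_one hd).2 (by linarith [hx.2])
    rw [← h] at this
    exact lt_irrefl _ this

theorem projIcc_affineCoord {a b : ℝ} {x : unitInterval} (hx : (x : ℝ) ∈ Ioo a b) :
    projIcc (0:ℝ) 1 zero_le_one (a + (b - a) * affineCoord a b x) = x := by
  have hd : b - a ≠ 0 := (sub_pos.2 (hx.1.trans hx.2)).ne'
  rw [coe_affineCoord hx, mul_div_cancel₀ _ hd, add_sub_cancel, projIcc_val]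

theorem UExtension.exists_insertion {X : Type*} [MetricSpace X] {γ γ' : unitInterval → X}
    {𝒰 : Set (Set ℝ)} (hγ : IsCantorPath γ) (hγ' : Continuous γ') (h : UExtension γ γ' 𝒰)
    {ε : ℝ} (hε : 0 < ε) :
    ∃ (W : Set unitInterval) (e : unitInterval → ℝ), LoopInsertion γ γ' W e ∧ ∀ x, e x ≤ ε := by
  obtain ⟨hcomp, hoff, hloop⟩ := h
  obtain ⟨hO, hO01, -⟩ := hγ.2.2
  have hJO : ∀ J ∈ 𝒰, J ⊆ Oset γ := fun J hJ => by
    obtain ⟨x, -, rfl⟩ := hcomp J hJ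
    exact connectedComponentIn_subset _ _
  have hJopen : ∀ J ∈ 𝒰, IsOpen J := fun J hJ => by
    obtain ⟨x, -, rfl⟩ := hcomp J hJ
    exact hO.connectedComponentIn
  have hJconn : ∀ J ∈ 𝒰, IsConnected J := fun J hJ => by
    obtain ⟨x, hx, rfl⟩ := hcomp J hJ
    exact isConnected_connectedComponentIn_iff.2 hx
  have hJmax : ∀ J ∈ 𝒰, ∀ x ∈ J, J = connectedComponentIn (Oset γ) x := fun J hJ x hx => by
    obtain ⟨x₀, -, rfl⟩ := hcomp J hJ
    exact connectedComponentIn_eq hx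
  have hJIoo : ∀ J ∈ 𝒰, J = Ioo (sInf J) (sSup J) := fun J hJ =>
    (hJconn J hJ).eq_Ioo_of_isOpen (hJopen J hJ)
      (bddBelow_Ioo.mono ((hJO J hJ).trans hO01)) (bddAbove_Ioo.mono ((hJO J hJ).trans hO01))
  have hJlt : ∀ J ∈ 𝒰, sInf J < sSup J := fun J hJ => by
    obtain ⟨x, hx⟩ := (hJconn J hJ).nonempty
    rw [hJIoo J hJ] at hx
    exact hx.1.trans hx.2
  have hctb : 𝒰.Countable := by
    refine Set.PairwiseDisjoint.countable_of_isOpen (s := id) ?_ hJopen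
      fun J hJ => (hJconn J hJ).nonempty
    intro J hJ J' hJ' hne
    refine Set.disjoint_left.2 fun x hx hx' => hne ?_
    rw [hJmax J hJ x hx, hJmax J' hJ' x hx']
  have := hctb.to_subtype
  let _ : Encodable 𝒰 := Encodable.ofCountable 𝒰
  have hcont : ∀ J : Set ℝ, Continuous (restrictIcc γ' (sInf J) (sSup J)) := fun J =>
    hγ'.comp (continuous_projIcc.comp (by fun_prop))
  choose η hηc hη0 hη1 hηnn hηle hηpos hηcode hηconst using
    fun J : 𝒰 => (hloop J J.2).exists_height (hcont J)
  let ψ : 𝒰 → unitInterval → unitInterval := fun J => affineCoord (sInf J.1) (sSup J.1)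
  have hψc : ∀ J, Continuous (ψ J) := fun J => continuous_affineCoord _ _
  obtain ⟨w, hw, a, hwa, ha⟩ := posSumOfEncodable hε 𝒰
  have hterm0 : ∀ J x, 0 ≤ w J * η J (ψ J x) := fun J x => mul_nonneg (hw J).le (hηnn J _)
  have hterm1 : ∀ J x, w J * η J (ψ J x) ≤ w J := fun J x =>
    mul_le_of_le_one_right (hw J).le (hηle J _)
  have hsum : ∀ x, Summable fun J => w J * η J (ψ J x) := fun x =>
    Summable.of_nonneg_of_le (fun J => hterm0 J x) (fun J => hterm1 J x) hwa.summable
  have hoffJ : ∀ (J : 𝒰) (x : unitInterval), (x : ℝ) ∉ J.1 → w J * η J (ψ J x) = 0 := by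
    intro J x hx
    rw [hJIoo J J.2] at hx
    rcases affineCoord_eq_zero_or_one (hJlt J J.2) hx with h | h
    · simp only [ψ, h, hη0, mul_zero]
    · simp only [ψ, h, hη1, mul_zero]
  have honJ : ∀ (J : 𝒰) (x : unitInterval), (x : ℝ) ∈ J.1 →
      ∑' J, w J * η J (ψ J x) = w J * η J (ψ J x) := by
    intro J x hx
    refine tsum_eq_single J fun J' hne => hoffJ J' x fun hx' => hne (Subtype.ext ?_)
    rw [hJmax J J.2 x hx, hJmax J' J'.2 x hx']
  have hrestr : ∀ (J : 𝒰) (x : unitInterval), (x : ℝ) ∈ J.1 →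
      restrictIcc γ' (sInf J.1) (sSup J.1) (ψ J x) = γ' x := by
    intro J x hx
    rw [hJIoo J J.2] at hx
    rw [restrictIcc, projIcc_affineCoord hx]
  let W : Set unitInterval := {x | (x : ℝ) ∈ ⋃₀ 𝒰}
  have hWO : ∀ x ∈ W, (x : ℝ) ∈ Oset γ := by
    rintro x ⟨J, hJ, hx⟩
    exact hJO J hJ hx
  have hsame : ∀ x y, uIcc x y ⊆ W → ∃ J : 𝒰, ∀ z ∈ uIcc x y, (z : ℝ) ∈ J.1 := by
    intro x y hxy
    obtain ⟨J, hJ, hx⟩ := hxy left_mem_uIcc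
    refine ⟨⟨J, hJ⟩, fun z hz => ?_⟩
    have hpre : IsPreconnected (((↑) : unitInterval → ℝ) '' uIcc x y) :=
      isPreconnected_uIcc.image _ continuous_subtype_val.continuousOn
    have hsub := hpre.subset_connectedComponentIn (F := Oset γ) (mem_image_of_mem _ left_mem_uIcc)
      (by rintro _ ⟨u, hu, rfl⟩; exact hWO u (hxy hu))
    rw [← hJmax J hJ x hx] at hsub
    exact hsub (mem_image_of_mem _ hz)
  refine ⟨W, fun x => ∑' J, w J * η J (ψ J x), ?_, fun x =>
    ((hsum x).tsum_le_tsum (fun J => hterm1 J x) hwa.summable).trans (hwa.tsum_eq.le.trans ha)⟩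
  refine
    { isOpen := (isOpen_sUnion hJopen).preimage continuous_subtype_val
      zero_notMem := fun h0 => lt_irrefl _ (hO01 (hWO 0 h0)).1
      one_notMem := fun h1 => lt_irrefl _ (hO01 (hWO 1 h1)).2
      continuous_height := ?_
      height_pos := ?_
      height_eq_zero := ?_
      const := fun x y hxy => eq_of_uIcc_subset_Oset fun z hz => hWO z (hxy hz)
      eq_off := hoff
      code := ?_
      height_const := ?_ }
  · refine continuous_tsum (fun J => continuous_const.mul ((hηc J).comp (hψc J)))
      hwa.summable fun J x => ?_
    rw [Real.norm_of_nonneg (hterm0 J x)]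
    exact hterm1 J x
  · rintro x ⟨J, hJ, hx⟩
    simp only [honJ ⟨J, hJ⟩ x hx]
    rw [hJIoo J hJ] at hx
    exact mul_pos (hw _) (hηpos _ _ (affineCoord_ne hx).1 (affineCoord_ne hx).2)
  · intro x hx
    have : ∀ J, w J * η J (ψ J x) = 0 := fun J => hoffJ J x fun hxJ => hx ⟨J, J.2, hxJ⟩
    simp [this]
  · intro x y hxy he
    obtain ⟨J, hJ⟩ := hsame x y hxy
    simp only [honJ J x (hJ x left_mem_uIcc), honJ J y (hJ y right_mem_uIcc)] at he
    rw [← hrestr J x (hJ x left_mem_uIcc), ← hrestr J y (hJ y right_mem_uIcc)]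
    exact hηcode J _ _ (mul_left_cancel₀ (hw J).ne' he)
  · intro x y hxy hc
    obtain ⟨J, hJ⟩ := hsame x y hxy
    simp only [honJ J x (hJ x left_mem_uIcc), honJ J y (hJ y right_mem_uIcc)]
    congr 1
    refine hηconst J _ _ fun u hu => ?_
    rw [hrestr J x (hJ x left_mem_uIcc)]
    refine hc _ ?_
    have hmono : Monotone fun u : unitInterval =>
        projIcc (0:ℝ) 1 zero_le_one (sInf J.1 + (sSup J.1 - sInf J.1) * u) := by
      intro u v huv
      refine monotone_projIcc _ ?_
      have : (u : ℝ) ≤ v := huv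
      have := mul_le_mul_of_nonneg_left this (sub_pos.2 (hJlt J J.2)).le
      linarith
    have hx := hJ x left_mem_uIcc
    have hy := hJ y right_mem_uIcc
    rw [hJIoo J J.2] at hx hy
    have := hmono.mapsTo_uIcc hu
    simpa only [ψ, projIcc_affineCoord hx, projIcc_affineCoord hy] using this

/-- A sequence of paths in which each path is obtained from its predecessor by inserting loops,
together with a height function `c` for the first path and summable heights for the insertions. -/
structure InsertionTower {X : Type*} (γ : ℕ → unitInterval → X) (W : ℕ → Set unitInterval)
    (e : ℕ → unitInterval → ℝ) (c : unitInterval → ℝ) : Prop where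
  insertion : ∀ k, LoopInsertion (γ k) (γ (k + 1)) (W k) (e k)
  height_le : ∀ k x, e k x ≤ (1 / 2 : ℝ) ^ k
  continuous_base : Continuous c
  base_code : ∀ x y, c x = c y → γ 0 x = γ 0 y
  base_const : ∀ x y, (∀ z ∈ uIcc x y, γ 0 z = γ 0 x) → c x = c y

/-- The height of the `k`-th path of a tower of insertions. -/
noncomputable def stageHeight (e : ℕ → unitInterval → ℝ) (c : unitInterval → ℝ) (k : ℕ)
    (x : unitInterval) : ℝ :=
  c x + ∑ j ∈ Finset.range k, e j x

/-- The height of the limit of a tower of insertions. -/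
noncomputable def limitHeight (e : ℕ → unitInterval → ℝ) (c : unitInterval → ℝ)
    (x : unitInterval) : ℝ :=
  c x + ∑' j, e j x

theorem stageHeight_zero (e : ℕ → unitInterval → ℝ) (c : unitInterval → ℝ) (x : unitInterval) :
    stageHeight e c 0 x = c x := by
  simp [stageHeight]

theorem stageHeight_succ (e : ℕ → unitInterval → ℝ) (c : unitInterval → ℝ) (k : ℕ)
    (x : unitInterval) : stageHeight e c (k + 1) x = stageHeight e c k x + e k x := by
  rw [stageHeight, stageHeight, Finset.sum_range_succ, add_assoc]

namespace InsertionTower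

variable {X : Type*} {γ : ℕ → unitInterval → X} {W : ℕ → Set unitInterval}
  {e : ℕ → unitInterval → ℝ} {c : unitInterval → ℝ}

theorem summable (h : InsertionTower γ W e c) (x : unitInterval) : Summable fun j => e j x :=
  Summable.of_nonneg_of_le (fun j => (h.insertion j).height_nonneg x)
    (fun j => h.height_le j x) summable_geometric_two

theorem continuous_stageHeight (h : InsertionTower γ W e c) (k : ℕ) :
    Continuous (stageHeight e c k) :=
  h.continuous_base.add (continuous_finsetSum _ fun j _ => (h.insertion j).continuous_height)

theorem continuous_limitHeight (h : InsertionTower γ W e c) : Continuous (limitHeight e c) := by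
  refine h.continuous_base.add (continuous_tsum
    (fun j => (h.insertion j).continuous_height) summable_geometric_two fun j x => ?_)
  rw [Real.norm_of_nonneg ((h.insertion j).height_nonneg x)]
  exact h.height_le j x

theorem base_le_limitHeight (h : InsertionTower γ W e c) (x : unitInterval) :
    c x ≤ limitHeight e c x :=
  le_add_of_nonneg_right (tsum_nonneg fun j => (h.insertion j).height_nonneg x)

theorem monotone_stageHeight (h : InsertionTower γ W e c) (x : unitInterval) :
    Monotone fun k => stageHeight e c k x :=
  monotone_nat_of_le_succ fun k => by
    rw [stageHeight_succ]
    exact le_add_of_nonneg_right ((h.insertion k).height_nonneg x)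

theorem stageHeight_lt_succ (h : InsertionTower γ W e c) {k : ℕ} {x : unitInterval}
    (hx : x ∈ W k) : stageHeight e c k x < stageHeight e c (k + 1) x := by
  rw [stageHeight_succ]
  exact lt_add_of_pos_right _ ((h.insertion k).height_pos x hx)

theorem stageHeight_lt_limitHeight (h : InsertionTower γ W e c) {k : ℕ} {x : unitInterval}
    (hx : x ∈ W k) : stageHeight e c k x < limitHeight e c x :=
  (h.stageHeight_lt_succ hx).trans_le (add_le_add le_rfl
    ((h.summable x).sum_le_tsum _ fun j _ => (h.insertion j).height_nonneg x))

theorem stageHeight_succ_of_notMem (h : InsertionTower γ W e c) {k : ℕ} {x : unitInterval}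
    (hx : x ∉ W k) : stageHeight e c (k + 1) x = stageHeight e c k x := by
  rw [stageHeight_succ, (h.insertion k).height_eq_zero x hx, add_zero]

theorem limitHeight_eq_stageHeight (h : InsertionTower γ W e c) {k : ℕ} {x : unitInterval}
    (hx : ∀ j ≥ k, x ∉ W j) : limitHeight e c x = stageHeight e c k x := by
  rw [limitHeight, stageHeight, tsum_eq_sum (s := Finset.range k)]
  intro j hj
  exact (h.insertion j).height_eq_zero x (hx j (by simpa using hj))

/-- A stage height is constant on every interval on which its path is constant. -/
theorem stageHeight_const (h : InsertionTower γ W e c) (k : ℕ) :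
    ∀ x y, (∀ z ∈ uIcc x y, γ k z = γ k x) → stageHeight e c k x = stageHeight e c k y := by
  induction k with
  | zero =>
    intro x y hc
    rw [stageHeight_zero, stageHeight_zero, h.base_const x y hc]
  | succ k ih =>
    intro x y hc
    have hk := h.insertion k
    by_cases hsub : uIcc x y ⊆ W k
    · rw [stageHeight_succ, stageHeight_succ, hk.height_const x y hsub hc, ih x y]
      intro z hz
      exact hk.const _ _ ((uIcc_subset_uIcc hz left_mem_uIcc).trans hsub)
    by_cases hdisj : ∀ z ∈ uIcc x y, z ∉ W k
    · rw [h.stageHeight_succ_of_notMem (hdisj x left_mem_uIcc),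
        h.stageHeight_succ_of_notMem (hdisj y right_mem_uIcc), ih x y]
      intro z hz
      rw [← hk.eq_off z (hdisj z hz), ← hk.eq_off x (hdisj x left_mem_uIcc), hc z hz]
    · exfalso
      push Not at hdisj
      obtain ⟨w, hw, hwW⟩ := hdisj
      obtain ⟨w', hw', hwW'⟩ := not_subset.1 hsub
      obtain ⟨b, hb, hbW, -, hbcl⟩ := exists_exit_point hk.isOpen hwW hwW'
      have hclosed : IsClosed {z | e k z = e k w} :=
        isClosed_eq hk.continuous_height continuous_const
      have hbe : e k b = e k w := by
        refine closure_minimal ?_ hclosed hbcl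
        rintro z ⟨hz, hzW⟩
        refine (hk.height_const w z hzW fun u hu => ?_).symm
        have hzx : z ∈ uIcc x y :=
          uIcc_subset_uIcc hw (uIcc_subset_uIcc hw hw' hb) hz
        rw [hc w hw, hc u (uIcc_subset_uIcc hw hzx hu)]
      have := hk.height_pos w hwW
      rw [← hbe, hk.height_eq_zero b hbW] at this
      exact lt_irrefl _ this

theorem stageHeight_eq (h : InsertionTower γ W e c) {k : ℕ} {x y : unitInterval}
    (hxy : uIcc x y ⊆ W k) : stageHeight e c k x = stageHeight e c k y :=
  h.stageHeight_const k x y fun _ hz =>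
    (h.insertion k).const _ _ ((uIcc_subset_uIcc hz left_mem_uIcc).trans hxy)

/-- End points of components of `W k` never get covered by later insertions. -/
theorem notMem_of_mem_closure (h : InsertionTower γ W e c) {k : ℕ} {b : unitInterval}
    (hb : b ∉ W k)
    (hcl : b ∈ closure {z | z ∈ W k ∧ stageHeight e c k z = stageHeight e c k b}) :
    ∀ j ≥ k, b ∉ W j := by
  suffices ∀ j ≥ k, b ∉ W j ∧ stageHeight e c j b = stageHeight e c k b from
    fun j hj => (this j hj).1
  intro j hj
  induction j, hj using Nat.le_induction with
  | base => exact ⟨hb, rfl⟩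
  | succ j hj ih =>
    have hbj : stageHeight e c (j + 1) b = stageHeight e c k b := by
      rw [h.stageHeight_succ_of_notMem ih.1, ih.2]
    refine ⟨fun hbW => ?_, hbj⟩
    obtain ⟨u, v, hbuv, hN, hsub⟩ :=
      exists_Icc_mem_subset_of_mem_nhds ((h.insertion (j + 1)).isOpen.mem_nhds hbW)
    obtain ⟨z, hzN, hzW, hz⟩ := mem_closure_iff_nhds.1 hcl _ hN
    have h1 := h.stageHeight_eq ((ordConnected_Icc.uIcc_subset hzN hbuv).trans hsub)
    have h2 := h.stageHeight_lt_succ hzW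
    have h3 : stageHeight e c (k + 1) z ≤ stageHeight e c (j + 1) z :=
      h.monotone_stageHeight z (Nat.succ_le_succ hj)
    linarith

theorem exists_limitHeight_eq (h : InsertionTower γ W e c) {k : ℕ} {x y : unitInterval}
    (hx : x ∈ W k) (hy : y ∉ W k) :
    ∃ b ∈ uIcc x y, limitHeight e c b = stageHeight e c k x := by
  obtain ⟨b, hb, hbW, -, hbcl⟩ := exists_exit_point (h.insertion k).isOpen hx hy
  have hclosed : IsClosed {z | stageHeight e c k z = stageHeight e c k x} :=
    isClosed_eq (h.continuous_stageHeight k) continuous_const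
  have hbe : stageHeight e c k b = stageHeight e c k x := by
    refine closure_minimal ?_ hclosed hbcl
    rintro z ⟨-, hzW⟩
    exact (h.stageHeight_eq hzW).symm
  refine ⟨b, hb, ?_⟩
  rw [← hbe]
  refine h.limitHeight_eq_stageHeight (h.notMem_of_mem_closure hbW (closure_mono ?_ hbcl))
  rintro z ⟨-, hzW⟩
  exact ⟨hzW right_mem_uIcc, by rw [hbe, h.stageHeight_eq hzW]⟩

theorem mem_of_le_limitHeight (h : InsertionTower γ W e c) {k : ℕ} {x y : unitInterval}
    (hx : x ∈ W k) (hmin : ∀ z ∈ uIcc x y, limitHeight e c x ≤ limitHeight e c z) : y ∈ W k := by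
  by_contra hy
  obtain ⟨b, hb, hbe⟩ := h.exists_limitHeight_eq hx hy
  have h1 := hmin b hb
  have h2 := h.stageHeight_lt_limitHeight hx
  linarith

theorem apply_eq_of_notMem (h : InsertionTower γ W e c) {x : unitInterval}
    (hx : ∀ k, x ∉ W k) (k : ℕ) : γ k x = γ 0 x := by
  induction k with
  | zero => rfl
  | succ k ih => rw [(h.insertion k).eq_off x (hx k), ih]

theorem apply_eq_of_code (h : InsertionTower γ W e c) {x y : unitInterval}
    (hxy : limitHeight e c x = limitHeight e c y)
    (hmin : ∀ z ∈ uIcc x y, limitHeight e c x ≤ limitHeight e c z) (k : ℕ) : γ k x = γ k y := by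
  have hdich : ∀ j, uIcc x y ⊆ W j ∨ (x ∉ W j ∧ y ∉ W j) := by
    intro j
    by_cases hx : x ∈ W j
    · exact Or.inl fun z hz => h.mem_of_le_limitHeight hx fun u hu =>
        hmin u (uIcc_subset_uIcc left_mem_uIcc hz hu)
    · exact Or.inr ⟨hx, fun hy => hx (h.mem_of_le_limitHeight hy fun u hu => by
        rw [← hxy]
        exact hmin u (by rwa [uIcc_comm]))⟩
  have hlater : ∀ m k, uIcc x y ⊆ W (k + m) → stageHeight e c k x = stageHeight e c k y := by
    intro m
    induction m with
    | zero => exact fun k hk => h.stageHeight_eq hk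
    | succ m ih =>
      intro k hk
      rcases hdich k with hd | ⟨hx, hy⟩
      · exact h.stageHeight_eq hd
      · rw [← h.stageHeight_succ_of_notMem hx, ← h.stageHeight_succ_of_notMem hy]
        exact ih (k + 1) (by rwa [add_right_comm, add_assoc])
  have hstage : ∀ k, stageHeight e c k x = stageHeight e c k y := by
    intro k
    by_cases hk : ∃ m, uIcc x y ⊆ W (k + m)
    · obtain ⟨m, hm⟩ := hk
      exact hlater m k hm
    · push Not at hk
      have hnot : ∀ j ≥ k, x ∉ W j ∧ y ∉ W j := fun j hj => by
        obtain ⟨m, rfl⟩ := Nat.exists_eq_add_of_le hj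
        exact (hdich _).resolve_left (hk m)
      rw [← h.limitHeight_eq_stageHeight fun j hj => (hnot j hj).1,
        ← h.limitHeight_eq_stageHeight fun j hj => (hnot j hj).2, hxy]
  induction k with
  | zero => exact h.base_code x y (by simpa only [stageHeight_zero] using hstage 0)
  | succ k ih =>
    rcases hdich k with hd | ⟨hx, hy⟩
    · refine (h.insertion k).code x y hd ?_
      have h1 := hstage (k + 1)
      rw [stageHeight_succ, stageHeight_succ, hstage k] at h1
      exact add_left_cancel h1
    · rw [(h.insertion k).eq_off x hx, (h.insertion k).eq_off y hy, ih]

/-- The first path of a tower of insertions is `ℝ`-tree homotopic to the limit of the tower. -/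
theorem rTreeHomotopic [TopologicalSpace X] [T2Space X] (h : InsertionTower γ W e c)
    (hc0 : c 0 = 0) (hc : ∀ x, 0 ≤ c x) (hγ : Continuous (γ 0)) {γlim : unitInterval → X}
    (hlim : Continuous γlim) (htend : ∀ x, Tendsto (fun k => γ k x) atTop (𝓝 (γlim x))) :
    RTreeHomotopic (γ 0) γlim := by
  have hoff : ∀ x, (∀ k, x ∉ W k) → γ 0 x = γlim x ∧ limitHeight e c x = c x := by
    intro x hx
    refine ⟨tendsto_nhds_unique ?_ (htend x), ?_⟩
    · simp only [h.apply_eq_of_notMem hx, tendsto_const_nhds]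
    · rw [h.limitHeight_eq_stageHeight (k := 0) fun j _ => hx j, stageHeight_zero]
  obtain ⟨hγ0, hh0⟩ := hoff 0 fun k => (h.insertion k).zero_notMem
  obtain ⟨hγ1, hh1⟩ := hoff 1 fun k => (h.insertion k).one_notMem
  let H : C(unitInterval, ℝ) := ⟨ConcatReverse c (limitHeight e c),
    continuous_concatReverse h.continuous_base h.continuous_limitHeight hh1.symm⟩
  have Hl : ∀ u, H (leftHalf u) = c u := concatReverse_leftHalf
  have Hr : ∀ u, H (rightHalf u) = limitHeight e c u := concatReverse_rightHalf hh1.symm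
  have H0 : H 0 = 0 := by rw [← leftHalf_zero, Hl, hc0]
  have H1 : H 1 = 0 := by rw [← rightHalf_zero, Hr, hh0, hc0]
  have hmixed : ∀ u v, H (leftHalf u) = H (rightHalf v) →
      (∀ z ∈ uIcc (leftHalf u) (rightHalf v), H (rightHalf v) ≤ H z) → γ 0 u = γlim v := by
    intro u v huv hmin
    rw [Hl, Hr] at huv
    rw [uIcc_of_le (leftHalf_le_rightHalf u v)] at hmin
    have hv : ∀ k, v ∉ W k := fun k hk =>
      (h.insertion k).one_notMem (h.mem_of_le_limitHeight hk fun z hz => by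
        rw [uIcc_of_le unitInterval.le_one'] at hz
        simpa only [Hr] using
          hmin (rightHalf z) ⟨leftHalf_le_rightHalf u z, antitone_rightHalf hz.1⟩)
    rw [← (hoff v hv).1]
    exact h.base_code u v (by rw [huv, (hoff v hv).2])
  refine ⟨hγ0, hγ1, exists_rTree_factorization H
    (continuous_concatReverse hγ hlim hγ1) ?_ (H0.trans H1.symm) ?_⟩
  · intro s t hst hmin
    rcases eq_leftHalf_or_eq_rightHalf s with ⟨u, rfl⟩ | ⟨u, rfl⟩ <;>
      rcases eq_leftHalf_or_eq_rightHalf t with ⟨v, rfl⟩ | ⟨v, rfl⟩ <;>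
      simp only [concatReverse_leftHalf, concatReverse_rightHalf hγ1]
    · exact h.base_code u v (by rwa [Hl, Hl] at hst)
    · exact hmixed u v hst fun z hz => hst ▸ hmin z hz
    · exact (hmixed v u hst.symm fun z hz => hmin z (by rwa [uIcc_comm])).symm
    · rw [Hr, Hr] at hst
      refine tendsto_nhds_unique (htend u) ?_
      refine (htend v).congr fun k => (h.apply_eq_of_code hst (fun z hz => ?_) k).symm
      simpa only [Hr] using hmin (rightHalf z) (antitone_rightHalf.mapsTo_uIcc hz)
  · intro z
    rw [H0]
    rcases eq_leftHalf_or_eq_rightHalf z with ⟨u, rfl⟩ | ⟨u, rfl⟩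
    · rw [Hl]; exact hc u
    · rw [Hr]; exact (hc u).trans (h.base_le_limitHeight u)

end InsertionTower

theorem rTreeHomotopic_limit {X : Type*} [MetricSpace X] {γ : ℕ → unitInterval → X}
    {γlim : unitInterval → X} (hc : ∀ n, IsCantorPath (γ n))
    (hext : ∀ n, PrecExt (γ n) (γ (n + 1))) (hγ : Continuous γlim)
    (htend : ∀ x, Tendsto (fun k => γ k x) atTop (𝓝 (γlim x))) :
    RTreeHomotopic (γ 0) γlim := by
  obtain ⟨c, hcc, hc0, hcnn, -, hcode, hconst⟩ := exists_path_height (hc 0).1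
  have hins : ∀ k, ∃ (W : Set unitInterval) (e : unitInterval → ℝ),
      LoopInsertion (γ k) (γ (k + 1)) W e ∧ ∀ x, e x ≤ (1 / 2 : ℝ) ^ k := fun k => by
    obtain ⟨𝒰, h𝒰⟩ := hext k
    exact h𝒰.exists_insertion (hc k) (hc (k + 1)).1 (by positivity)
  choose W e hWe hle using hins
  have htower : InsertionTower γ W e c :=
    { insertion := hWe
      height_le := hle
      continuous_base := hcc
      base_code := fun x y hxy => (hcode x y hxy y right_mem_uIcc).symm
      base_const := hconst }
  exact htower.rTreeHomotopic hc0 hcnn (hc 0).1 hγ htend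

/-- A uniformly convergent sequence of Cantor paths, each a `⪯*`-extension of the previous
one, is ℝ-tree homotopic to its limit at every stage. -/
theorem gamma_extension_limit {X : Type*} [MetricSpace X]
    (γ : ℕ → unitInterval → X) (γlim : unitInterval → X)
    (hc : ∀ n, IsCantorPath (γ n)) (hext : ∀ n, PrecExt (γ n) (γ (n + 1)))
    (hγ : Continuous γlim)
    (hconv : TendstoUniformly (fun n => γ n) γlim Filter.atTop) :
    ∀ n, RTreeHomotopic (γ n) γlim := by
  intro n
  refine rTreeHomotopic_limit (γ := fun k => γ (n + k)) (fun k => hc _) (fun k => hext _) hγ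
    fun x => ?_
  simpa only [add_comm n] using (tendsto_add_atTop_iff_nat n).2 (hconv.tendsto_at x)
end
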